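/- arXiv:1004.4671 — 4 statements merged into one kernel-verified Lean document; each statement's English description precedes it below -/
import Mathlib

section
/- A function f : (0,∞) → ℝ is completely monotone (i.e. f is infinitely differentiable and (-1)^n f^{(n)}(x) ≥ 0 for all n ≥ 0 and x > 0) if and only if there exists a positive (Borel) measure μ on [0,∞) such that f(x) = ∫_{[0,∞)} e^{-zx} dμ(z) for all x > 0. -/
open MeasureTheory Real Set

/-- A function on `(0, ∞)` together with a sequence of successive derivatives of alternating
sign. -/
def HasAlternatingDerivs (F : ℕ → ℝ → ℝ) : Prop :=
  ∀ (n : ℕ) (x : ℝ), 0 < x → HasDerivAt (F n) (F (n + 1) x) x ∧ 0 ≤ (-1 : ℝ) ^ n * F n x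

theorem HasAlternatingDerivs.antitoneOn {F : ℕ → ℝ → ℝ} (hF : HasAlternatingDerivs F) (n : ℕ) :
    AntitoneOn (fun x => (-1 : ℝ) ^ n * F n x) (Ioi 0) := by
  have hd : ∀ x : ℝ, 0 < x →
      HasDerivAt (fun x => (-1 : ℝ) ^ n * F n x) ((-1 : ℝ) ^ n * F (n + 1) x) x :=
    fun x hx => (hF n x hx).1.const_mul _
  refine antitoneOn_of_deriv_nonpos (convex_Ioi 0)
    (fun x hx => (hd x hx).continuousAt.continuousWithinAt)
    (fun x hx => (hd x (interior_subset hx)).differentiableAt.differentiableWithinAt)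
    fun x hx => ?_
  have hx : 0 < x := interior_subset hx
  have := (hF (n + 1) x hx).2
  rw [(hd x hx).deriv]
  rw [pow_succ] at this
  linarith

theorem HasAlternatingDerivs.sub_shift {F : ℕ → ℝ → ℝ} (hF : HasAlternatingDerivs F) {h : ℝ}
    (hh : 0 ≤ h) : HasAlternatingDerivs fun n x => F n x - F n (x + h) := by
  refine fun n x hx => ⟨(hF n x hx).1.sub ((hF n (x + h) (by positivity)).1.comp_add_const x h), ?_⟩
  have := hF.antitoneOn n hx (show x + h ∈ Ioi 0 from add_pos_of_pos_of_nonneg hx hh)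
    (by linarith)
  simp only at this
  linarith

/-- The difference operator `c ↦ (k ↦ c k - c (k + 1))` on real sequences. -/
def seqDiff : Module.End ℝ (ℕ → ℝ) := 1 - LinearMap.funLeft ℝ ℝ Nat.succ

theorem seqDiff_apply (c : ℕ → ℝ) (k : ℕ) : seqDiff c k = c k - c (k + 1) := rfl

theorem HasAlternatingDerivs.seqDiff_pow_nonneg {F : ℕ → ℝ → ℝ} (hF : HasAlternatingDerivs F)
    {a h : ℝ} (ha : 0 < a) (hh : 0 ≤ h) (n k : ℕ) :
    0 ≤ (seqDiff ^ n) (fun k : ℕ => F 0 (a + k * h)) k := by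
  induction n generalizing F with
  | zero => simpa using (hF 0 (a + k * h) (by positivity)).2
  | succ n ih =>
    convert ih (hF.sub_shift hh) using 1
    rw [pow_succ, Module.End.mul_apply]
    refine congrFun (congrArg _ (funext fun j => ?_)) k
    rw [seqDiff_apply]
    push_cast
    ring_nf

theorem funLeft_succ_pow_apply (c : ℕ → ℝ) (j k : ℕ) :
    (LinearMap.funLeft ℝ ℝ Nat.succ ^ j) c k = c (k + j) := by
  induction j generalizing k with
  | zero => rfl
  | succ j ih =>
    rw [pow_succ', Module.End.mul_apply, LinearMap.funLeft_apply, ih]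
    congr 1
    omega

theorem sum_choose_mul_seqDiff_pow (c : ℕ → ℝ) (m k : ℕ) :
    ∑ j ∈ Finset.range (m + 1), (m.choose j : ℝ) * (seqDiff ^ (m - j)) c (k + j) = c k := by
  have hcomm : Commute (LinearMap.funLeft ℝ ℝ Nat.succ) seqDiff :=
    (Commute.one_right _).sub_right (Commute.refl _)
  have h := congrArg (fun T : Module.End ℝ (ℕ → ℝ) => T c k) (hcomm.add_pow m)
  have h1 : LinearMap.funLeft ℝ ℝ Nat.succ + seqDiff = 1 := by simp [seqDiff]
  simp only [h1, one_pow, Module.End.one_apply, LinearMap.sum_apply, Finset.sum_apply] at h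
  rw [h]
  refine Finset.sum_congr rfl fun j _ => ?_
  rw [← Nat.cast_comm, ← nsmul_eq_mul _ (_ * _ : Module.End ℝ (ℕ → ℝ)), LinearMap.smul_apply,
    Pi.smul_apply, nsmul_eq_mul, Module.End.mul_apply, funLeft_succ_pow_apply]

theorem sum_choose_mul_seqDiff_pow_mul_choose_div (c : ℕ → ℝ) {n k : ℕ} (hk : k ≤ n) :
    ∑ j ∈ Finset.range (n + 1), (n.choose j : ℝ) * (seqDiff ^ (n - j)) c j *
      ((j.choose k : ℝ) / n.choose k) = c k := by
  obtain ⟨m, rfl⟩ := Nat.exists_eq_add_of_le hk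
  have hpos : ((k + m).choose k : ℝ) ≠ 0 := by exact_mod_cast (Nat.choose_pos hk).ne'
  rw [add_assoc, Finset.sum_range_add, Finset.sum_eq_zero, zero_add]
  · rw [← sum_choose_mul_seqDiff_pow c m k]
    refine Finset.sum_congr rfl fun j hj => ?_
    have hj : j ≤ m := by simpa [Nat.lt_succ_iff] using hj
    have h : ((k + m).choose (k + j) : ℝ) * (k + j).choose k = (k + m).choose k * m.choose j := by
      have := Nat.choose_mul (n := k + m) (k := k + j) (s := k) (by omega)
      simp only [Nat.add_sub_cancel_left] at this
      exact_mod_cast this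
    rw [Nat.add_sub_add_left]
    field_simp
    linear_combination (seqDiff ^ (m - j)) c (k + j) * h
  · intro j hj
    simp [Nat.choose_eq_zero_of_lt (Finset.mem_range.1 hj)]

theorem abs_choose_div_choose_sub_pow_le {n j k : ℕ} (hj : j ≤ n) (hk : k < n) :
    |(j.choose k : ℝ) / n.choose k - (j / n : ℝ) ^ k| ≤ k ^ 2 / (n - k) := by
  induction k with
  | zero => simp
  | succ k ih =>
    have ih := ih (by omega)
    have hn : (0 : ℝ) < n := by exact_mod_cast (by omega : 0 < n)
    have hkn : (k : ℝ) + 1 < n := by exact_mod_cast hk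
    have hjn : (j : ℝ) ≤ n := by exact_mod_cast hj
    have hc : (0 : ℝ) < n.choose k := by exact_mod_cast Nat.choose_pos (by omega)
    have hx : (j / n : ℝ) ≤ 1 := (div_le_one hn).2 hjn
    have hR : (j.choose k : ℝ) / n.choose k ≤ 1 :=
      (div_le_one hc).2 (by exact_mod_cast Nat.choose_le_choose k hj)
    have hR0 : 0 ≤ (j.choose k : ℝ) / n.choose k := by positivity
    have hstep : ∀ i : ℕ, (i.choose (k + 1) : ℝ) * (k + 1) = i.choose k * (i - k) := by
      intro i
      rcases lt_or_ge i k with h | h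
      · simp [Nat.choose_eq_zero_of_lt h, Nat.choose_eq_zero_of_lt (h.trans (Nat.lt_succ_self k))]
      · rw [← Nat.cast_sub h]
        exact_mod_cast Nat.choose_succ_right_eq i k
    have hrec : (j.choose (k + 1) : ℝ) / n.choose (k + 1) =
        (j.choose k : ℝ) / n.choose k * ((j - k) / (n - k)) := by
      have h1 := hstep j
      have h2 := hstep n
      have hnk : (n : ℝ) - k ≠ 0 := by linarith
      have hc' : (n.choose (k + 1) : ℝ) ≠ 0 := by
        exact_mod_cast (Nat.choose_pos (by omega)).ne'
      rw [div_mul_div_comm, ← h1, ← h2, mul_div_mul_right _ _ (by positivity)]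
    have hdiff : |((j : ℝ) - k) / (n - k) - j / n| ≤ k / (n - k) := by
      have hnk : 0 < (n : ℝ) - k := by linarith
      have : ((j : ℝ) - k) / (n - k) - j / n = -(k / (n - k) * (1 - j / n)) := by
        field_simp
        ring
      rw [this, abs_neg, abs_of_nonneg (by have := sub_nonneg.2 hx; positivity)]
      have : 0 ≤ (j / n : ℝ) := by positivity
      exact mul_le_of_le_one_right (by positivity) (by linarith)
    have hsplit : (j.choose (k + 1) : ℝ) / n.choose (k + 1) - (j / n : ℝ) ^ (k + 1) =
        (j.choose k : ℝ) / n.choose k * (((j : ℝ) - k) / (n - k) - j / n) +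
          ((j.choose k : ℝ) / n.choose k - (j / n : ℝ) ^ k) * (j / n) := by
      rw [hrec]
      ring
    rw [hsplit]
    calc _ ≤ 1 * (k / (n - k) : ℝ) + k ^ 2 / (n - k) * 1 := by
          refine (abs_add_le _ _).trans (add_le_add ?_ ?_)
          · rw [abs_mul, abs_of_nonneg hR0]
            exact mul_le_mul hR hdiff (abs_nonneg _) zero_le_one
          · rw [abs_mul, abs_of_nonneg (by positivity : 0 ≤ (j / n : ℝ))]
            exact mul_le_mul ih hx (by positivity) ((abs_nonneg _).trans ih)
      _ = (k + k ^ 2) / (n - k) := by ring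
      _ ≤ ((k + 1 : ℕ) : ℝ) ^ 2 / (n - (k + 1 : ℕ)) := by
          push_cast
          refine div_le_div₀ (by positivity) (by nlinarith) (by linarith) (by linarith)

theorem integrable_continuous_unitInterval (μ : Measure unitInterval) [IsFiniteMeasure μ]
    {g : unitInterval → ℝ} (hg : Continuous g) : Integrable g μ :=
  (BoundedContinuousFunction.mkOfCompact ⟨g, hg⟩).integrable μ

theorem ext_of_forall_integral_pow_eq {μ ν : Measure unitInterval} [IsFiniteMeasure μ]
    [IsFiniteMeasure ν] (h : ∀ k : ℕ, ∫ t, (t : ℝ) ^ k ∂μ = ∫ t, (t : ℝ) ^ k ∂ν) : μ = ν := by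
  refine ext_of_forall_integral_eq_of_IsFiniteMeasure fun g => ?_
  have hclosed : IsClosed {g : C(unitInterval, ℝ) | ∫ t, g t ∂μ = ∫ t, g t ∂ν} := by
    have hcont : ∀ ρ : Measure unitInterval, IsFiniteMeasure ρ →
        Continuous fun g : C(unitInterval, ℝ) => ∫ t, g t ∂ρ := fun ρ _ =>
      (continuous_integral.comp (ContinuousMap.toLp (E := ℝ) 1 ρ ℝ).continuous).congr fun g =>
        integral_congr_ae (ContinuousMap.coeFn_toLp ρ g)
    exact isClosed_eq (hcont μ inferInstance) (hcont ν inferInstance)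
  have hpoly : (polynomialFunctions unitInterval : Set C(unitInterval, ℝ)) ⊆
      {g : C(unitInterval, ℝ) | ∫ t, g t ∂μ = ∫ t, g t ∂ν} := by
    rintro _ ⟨p, -, rfl⟩
    have hexp : ∀ t : unitInterval, p.toContinuousMapOn unitInterval t =
        ∑ k ∈ Finset.range (p.natDegree + 1), p.coeff k * (t : ℝ) ^ k := fun t => by
      simp [Polynomial.eval_eq_sum_range]
    simp only [mem_ofPred_eq]
    have hint : ∀ ρ : Measure unitInterval, IsFiniteMeasure ρ →
        ∫ t, p.toContinuousMapOn unitInterval t ∂ρ =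
          ∑ k ∈ Finset.range (p.natDegree + 1), p.coeff k * ∫ t, (t : ℝ) ^ k ∂ρ := by
      intro ρ _
      simp_rw [hexp]
      rw [integral_finsetSum _ fun k _ => integrable_continuous_unitInterval ρ (by fun_prop)]
      simp_rw [integral_const_mul]
    exact (hint μ inferInstance).trans
      ((Finset.sum_congr rfl fun k _ => by rw [h]).trans (hint ν inferInstance).symm)
  have hmem := hclosed.closure_subset_iff.2 hpoly
    (polynomialFunctions_closure_eq_top'.ge (Algebra.mem_top (x := g.toContinuousMap)))
  exact hmem

/-- The discrete measure on `[0, 1]` with mass `choose n j * (seqDiff ^ (n - j)) c j` at `j / n`. -/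
noncomputable def bernsteinMeasure (c : ℕ → ℝ) (n : ℕ) : Measure unitInterval :=
  ∑ j ∈ Finset.range (n + 1), ENNReal.ofReal ((n.choose j : ℝ) * (seqDiff ^ (n - j)) c j) •
    Measure.dirac (projIcc (0 : ℝ) 1 zero_le_one (j / n))

instance isFiniteMeasure_bernsteinMeasure (c : ℕ → ℝ) (n : ℕ) :
    IsFiniteMeasure (bernsteinMeasure c n) := by
  refine ⟨?_⟩
  rw [bernsteinMeasure, Measure.finsetSum_apply]
  exact ENNReal.sum_lt_top.2 fun j _ =>
    by simpa using ENNReal.mul_lt_top (ENNReal.natCast_lt_top _) ENNReal.ofReal_lt_top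

theorem integral_bernsteinMeasure {c : ℕ → ℝ} (hc : ∀ n k, 0 ≤ (seqDiff ^ n) c k) (n : ℕ)
    {g : ℝ → ℝ} (hg : Continuous g) :
    ∫ t, g t ∂bernsteinMeasure c n =
      ∑ j ∈ Finset.range (n + 1), (n.choose j : ℝ) * (seqDiff ^ (n - j)) c j * g (j / n) := by
  have hg' : Continuous fun t : unitInterval => g t := hg.comp continuous_subtype_val
  rw [bernsteinMeasure, integral_finsetSum_measure fun j _ =>
    (integrable_continuous_unitInterval _ hg').smul_measure ENNReal.ofReal_ne_top]
  refine Finset.sum_congr rfl fun j hj => ?_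
  have hjn : (j : ℝ) ≤ n := by exact_mod_cast Finset.mem_range_succ_iff.1 hj
  rw [integral_smul_measure, integral_dirac, ENNReal.toReal_ofReal
    (mul_nonneg (Nat.cast_nonneg _) (hc _ _)), smul_eq_mul,
    projIcc_of_mem zero_le_one ⟨by positivity, div_le_one_of_le₀ hjn (Nat.cast_nonneg _)⟩]

theorem tendsto_integral_pow_bernsteinMeasure {c : ℕ → ℝ} (hc : ∀ n k, 0 ≤ (seqDiff ^ n) c k)
    (k : ℕ) :
    Filter.Tendsto (fun n => ∫ t, (t : ℝ) ^ k ∂bernsteinMeasure c n) Filter.atTop (nhds (c k)) := by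
  have hlim : Filter.Tendsto (fun n : ℕ => c 0 * ((k : ℝ) ^ 2 / (n - k))) Filter.atTop
      (nhds 0) := by
    have h1 : Filter.Tendsto (fun n : ℕ => (n : ℝ) - k) Filter.atTop Filter.atTop :=
      Filter.tendsto_atTop_add_const_right _ (-(k : ℝ)) tendsto_natCast_atTop_atTop
    simpa using (h1.const_div_atTop ((k : ℝ) ^ 2)).const_mul (c 0)
  rw [tendsto_iff_dist_tendsto_zero]
  refine squeeze_zero' (Filter.Eventually.of_forall fun _ => dist_nonneg) ?_ hlim
  filter_upwards [Filter.eventually_gt_atTop k] with n hn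
  rw [integral_bernsteinMeasure hc n (continuous_pow k), dist_comm, Real.dist_eq,
    ← sum_choose_mul_seqDiff_pow_mul_choose_div c hn.le, ← Finset.sum_sub_distrib,
    ← sum_choose_mul_seqDiff_pow_mul_choose_div c (Nat.zero_le n), Finset.sum_mul]
  refine (Finset.abs_sum_le_sum_abs _ _).trans (Finset.sum_le_sum fun j hj => ?_)
  have hw : 0 ≤ (n.choose j : ℝ) * (seqDiff ^ (n - j)) c j :=
    mul_nonneg (Nat.cast_nonneg _) (hc _ _)
  rw [← mul_sub, abs_mul, abs_of_nonneg hw, Nat.choose_zero_right, Nat.choose_zero_right,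
    Nat.cast_one, div_one, mul_one]
  exact mul_le_mul_of_nonneg_left
    (abs_choose_div_choose_sub_pow_le (Finset.mem_range_succ_iff.1 hj) hn) hw

/-- **Hausdorff moment problem**: a sequence all of whose iterated differences are nonnegative is
the moment sequence of a finite measure on `[0, 1]`. -/
theorem exists_measure_integral_pow_eq {c : ℕ → ℝ} (hc : ∀ n k, 0 ≤ (seqDiff ^ n) c k) :
    ∃ ν : Measure unitInterval, IsFiniteMeasure ν ∧ ∀ k : ℕ, ∫ t, (t : ℝ) ^ k ∂ν = c k := by
  let P : ℕ → FiniteMeasure unitInterval := fun n => ⟨bernsteinMeasure c n, inferInstance⟩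
  have hmass : ∀ n, (P n).mass ≤ (c 0).toNNReal := by
    intro n
    have h := integral_bernsteinMeasure hc n (continuous_const (y := (1 : ℝ)))
    have h0 := sum_choose_mul_seqDiff_pow_mul_choose_div c (Nat.zero_le n)
    simp only [Nat.choose_zero_right, Nat.cast_one, div_one] at h0
    rw [h0, integral_const, smul_eq_mul, mul_one] at h
    rw [← h, ← NNReal.coe_le_coe]
    exact Real.le_coe_toNNReal _
  let U : Ultrafilter ℕ := Filter.hyperfilter ℕ
  obtain ⟨ν, -, hν⟩ := (isCompact_setOfPred_finiteMeasure_le_of_compactSpace unitInterval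
    (c 0).toNNReal).ultrafilter_le_nhds' (U.map P) (Filter.mem_map.2
      (Filter.Eventually.of_forall hmass))
  refine ⟨ν, inferInstance, fun k => ?_⟩
  have hlim := FiniteMeasure.tendsto_iff_forall_integral_tendsto.1 hν
    (BoundedContinuousFunction.mkOfCompact ⟨fun t : unitInterval => (t : ℝ) ^ k, by fun_prop⟩)
  exact tendsto_nhds_unique (hlim.comp Filter.tendsto_map)
    ((tendsto_integral_pow_bernsteinMeasure hc k).mono_left Nat.hyperfilter_le_atTop)

theorem HasAlternatingDerivs.exists_measure_integral_pow_eq {F : ℕ → ℝ → ℝ}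
    (hF : HasAlternatingDerivs F) {h : ℝ} (hh : 0 < h) :
    ∃ ν : Measure unitInterval, IsFiniteMeasure ν ∧
      ∀ k : ℕ, ∫ t, (t : ℝ) ^ k ∂ν = F 0 (h + k * h) :=
  _root_.exists_measure_integral_pow_eq fun n k => hF.seqDiff_pow_nonneg hh hh.le n k

/-- The moment measures of the restrictions of a function to `ℕ₊` and to `m⁻¹ ℕ₊` correspond under
`t ↦ t ^ m`. -/
theorem map_pow_withDensity_eq {F : ℝ → ℝ} {m : ℕ} (hm : m ≠ 0) {ν ρ : Measure unitInterval}
    [IsFiniteMeasure ν] [IsFiniteMeasure ρ]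
    (hν : ∀ k : ℕ, ∫ t, (t : ℝ) ^ k ∂ν = F (1 + k * 1))
    (hρ : ∀ k : ℕ, ∫ t, (t : ℝ) ^ k ∂ρ = F ((m : ℝ)⁻¹ + k * (m : ℝ)⁻¹)) :
    (ρ.withDensity fun t => ENNReal.ofReal ((t : ℝ) ^ (m - 1))).map (fun t => t ^ m) = ν := by
  have hpow : Measurable fun t : unitInterval => t ^ m := (continuous_pow m).measurable
  have hdens : Measurable fun t : unitInterval => ENNReal.ofReal ((t : ℝ) ^ (m - 1)) := by fun_prop
  have : IsFiniteMeasure (ρ.withDensity fun t => ENNReal.ofReal ((t : ℝ) ^ (m - 1))) :=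
    isFiniteMeasure_withDensity_ofReal
      (integrable_continuous_unitInterval ρ (by fun_prop)).hasFiniteIntegral
  refine ext_of_forall_integral_pow_eq fun k => ?_
  rw [integral_map hpow.aemeasurable
    (by fun_prop : Continuous fun t : unitInterval => (t : ℝ) ^ k).aestronglyMeasurable,
    integral_withDensity_eq_integral_toReal_smul hdens (by simp), hν]
  have hkm : ((m : ℝ)⁻¹ + (m * k + (m - 1) : ℕ) * (m : ℝ)⁻¹) = 1 + k * 1 := by
    have : (m : ℝ) ≠ 0 := by exact_mod_cast hm
    rw [Nat.cast_add, Nat.cast_mul, Nat.cast_sub (Nat.one_le_iff_ne_zero.2 hm)]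
    field_simp
    push_cast
    ring
  rw [← hkm, ← hρ]
  refine integral_congr_ae (Filter.Eventually.of_forall fun t => ?_)
  have ht : (0 : ℝ) ≤ t := t.2.1
  simp only [smul_eq_mul, Icc.coe_pow]
  rw [ENNReal.toReal_ofReal (by positivity), ← pow_mul, ← pow_add, add_comm]

/-- The image under `t ↦ -log t` of the measure with density `t⁻¹` with respect to `ν`; the mass
at `0` is dropped because `0⁻¹ = 0`. -/
noncomputable def negLogMeasure (ν : Measure unitInterval) : Measure ℝ :=
  (ν.withDensity fun t => ENNReal.ofReal (t : ℝ)⁻¹).map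
    fun t : unitInterval => -log (t : ℝ)

theorem measurable_neg_log_unitInterval : Measurable fun t : unitInterval => -log (t : ℝ) := by
  fun_prop

theorem negLogMeasure_Iio_zero (ν : Measure unitInterval) : negLogMeasure ν (Iio 0) = 0 := by
  rw [negLogMeasure, Measure.map_apply measurable_neg_log_unitInterval measurableSet_Iio]
  have hempty : (fun t : unitInterval => -log (t : ℝ)) ⁻¹' Iio 0 = ∅ := by
    ext t
    simp [log_nonpos t.2.1 t.2.2]
  rw [hempty, measure_empty]

theorem lintegral_negLogMeasure (ν : Measure unitInterval) (x : ℝ) :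
    ∫⁻ z, ENNReal.ofReal (exp (-z * x)) ∂negLogMeasure ν =
      ∫⁻ t, ENNReal.ofReal ((t : ℝ)⁻¹ * exp (log t * x)) ∂ν := by
  rw [negLogMeasure, lintegral_map (by fun_prop) measurable_neg_log_unitInterval,
    lintegral_withDensity_eq_lintegral_mul _ (by fun_prop) (by fun_prop)]
  refine lintegral_congr fun t => ?_
  rw [Pi.mul_apply, neg_neg, ENNReal.ofReal_mul (inv_nonneg.2 t.2.1)]

theorem HasAlternatingDerivs.lintegral_negLogMeasure_div {F : ℕ → ℝ → ℝ}
    (hF : HasAlternatingDerivs F) {ν : Measure unitInterval} [IsFiniteMeasure ν]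
    (hν : ∀ k : ℕ, ∫ t, (t : ℝ) ^ k ∂ν = F 0 (1 + k * 1)) {m j : ℕ} (hm : m ≠ 0) (hj : j ≠ 0) :
    ∫⁻ z, ENNReal.ofReal (exp (-z * ((j + 1) / m))) ∂negLogMeasure ν =
      ENNReal.ofReal (F 0 ((j + 1) / m)) := by
  have hm0 : (0 : ℝ) < m := by exact_mod_cast Nat.pos_of_ne_zero hm
  obtain ⟨ρ, hρfin, hρ⟩ := hF.exists_measure_integral_pow_eq (inv_pos.2 hm0)
  rw [lintegral_negLogMeasure, ← map_pow_withDensity_eq hm hν hρ,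
    lintegral_map (by fun_prop) (continuous_pow m).measurable,
    lintegral_withDensity_eq_lintegral_mul _ (by fun_prop) (by fun_prop)]
  have hval : F 0 ((j + 1) / m) = ∫ t, (t : ℝ) ^ j ∂ρ := by
    rw [hρ]
    congr 1
    ring
  rw [hval, ofReal_integral_eq_lintegral_ofReal
    (integrable_continuous_unitInterval ρ (by fun_prop))
    (Filter.Eventually.of_forall fun t => pow_nonneg t.2.1 j)]
  refine lintegral_congr fun t => ?_
  rw [Pi.mul_apply, ← ENNReal.ofReal_mul (pow_nonneg t.2.1 _), Icc.coe_pow]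
  congr 1
  rcases t.2.1.eq_or_lt with ht | ht
  · simp [← ht, hm, hj]
  · have hexp : exp (log ((t : ℝ) ^ m) * ((j + 1) / m)) = (t : ℝ) ^ (j + 1) := by
      rw [log_pow, ← exp_log (pow_pos ht (j + 1)), log_pow]
      congr 1
      push_cast
      field_simp
    obtain ⟨m, rfl⟩ := Nat.exists_eq_succ_of_ne_zero hm
    rw [hexp, Nat.succ_sub_one, Nat.succ_eq_add_one, pow_succ (t : ℝ) m, pow_succ (t : ℝ) j]
    field_simp

theorem antitone_lintegral_exp {μ : Measure ℝ} (hμ : μ (Iio 0) = 0) :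
    Antitone fun x : ℝ => ∫⁻ z, ENNReal.ofReal (exp (-z * x)) ∂μ := by
  intro x y hxy
  have hae : ∀ᵐ z ∂μ, 0 ≤ z := by
    rw [ae_iff]
    simpa [← Iio_def] using! hμ
  refine lintegral_mono_ae ?_
  filter_upwards [hae] with z hz
  exact ENNReal.ofReal_le_ofReal (exp_le_exp.2 (by nlinarith))

theorem exists_natCast_add_one_div_mem_Ioo {a b : ℝ} (ha : 0 ≤ a) (hab : a < b) :
    ∃ m j : ℕ, m ≠ 0 ∧ j ≠ 0 ∧ ((j : ℝ) + 1) / m ∈ Ioo a b := by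
  obtain ⟨q, hq1, hq2⟩ := exists_rat_btwn hab
  have hq : 0 < q := by exact_mod_cast ha.trans_lt hq1
  have hnum := Rat.num_pos.2 hq
  obtain ⟨n, hn⟩ := Int.eq_ofNat_of_zero_le hnum.le
  have hn0 : 0 < n := by omega
  refine ⟨2 * q.den, 2 * n - 1, by simp, by omega, ?_⟩
  have : (((2 * n - 1 : ℕ) : ℝ) + 1) / (2 * q.den : ℕ) = q := by
    rw [Nat.cast_sub (by omega), Rat.cast_def, hn]
    push_cast
    rw [sub_add_cancel, mul_div_mul_left _ _ two_ne_zero]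
  rw [this]
  exact ⟨hq1, hq2⟩

theorem HasAlternatingDerivs.lintegral_negLogMeasure {F : ℕ → ℝ → ℝ}
    (hF : HasAlternatingDerivs F) {ν : Measure unitInterval} [IsFiniteMeasure ν]
    (hν : ∀ k : ℕ, ∫ t, (t : ℝ) ^ k ∂ν = F 0 (1 + k * 1)) {x : ℝ} (hx : 0 < x) :
    ∫⁻ z, ENNReal.ofReal (exp (-z * x)) ∂negLogMeasure ν = ENNReal.ofReal (F 0 x) := by
  have hanti := antitone_lintegral_exp (negLogMeasure_Iio_zero ν)
  have hcont : ContinuousAt (fun y => ENNReal.ofReal (F 0 y)) x :=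
    ENNReal.continuous_ofReal.continuousAt.comp (hF 0 x hx).1.continuousAt
  apply le_antisymm
  · by_contra! hlt
    obtain ⟨l, hl, hsub⟩ := exists_Ioc_subset_of_mem_nhds (hcont (Iio_mem_nhds hlt)) ⟨0, hx⟩
    obtain ⟨m, j, hm, hj, h1, h2⟩ := exists_natCast_add_one_div_mem_Ioo
      (le_max_right l 0) (max_lt hl hx)
    have h : ENNReal.ofReal (F 0 ((j + 1) / m)) < _ := hsub ⟨(le_max_left l 0).trans_lt h1, h2.le⟩
    rw [← hF.lintegral_negLogMeasure_div hν hm hj] at h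
    exact h.not_ge (hanti h2.le)
  · by_contra! hlt
    obtain ⟨u, hu, hsub⟩ := exists_Ico_subset_of_mem_nhds (hcont (Ioi_mem_nhds hlt))
      ⟨x + 1, by simp⟩
    obtain ⟨m, j, hm, hj, h1, h2⟩ := exists_natCast_add_one_div_mem_Ioo hx.le hu
    have h : _ < ENNReal.ofReal (F 0 ((j + 1) / m)) := hsub ⟨h1.le, h2⟩
    rw [← hF.lintegral_negLogMeasure_div hν hm hj] at h
    exact h.not_ge (hanti h1.le)

theorem HasAlternatingDerivs.exists_measure {F : ℕ → ℝ → ℝ} (hF : HasAlternatingDerivs F) :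
    ∃ μ : Measure ℝ, μ (Iio 0) = 0 ∧ ∀ x : ℝ, 0 < x →
      Integrable (fun z : ℝ => exp (-z * x)) μ ∧ F 0 x = ∫ z : ℝ, exp (-z * x) ∂μ := by
  obtain ⟨ν, hfin, hν⟩ := hF.exists_measure_integral_pow_eq one_pos
  refine ⟨negLogMeasure ν, negLogMeasure_Iio_zero ν, fun x hx => ?_⟩
  have hl := hF.lintegral_negLogMeasure hν hx
  have hmeas : AEStronglyMeasurable (fun z : ℝ => exp (-z * x)) (negLogMeasure ν) := by fun_prop
  have hpos : 0 ≤ᵐ[negLogMeasure ν] fun z : ℝ => exp (-z * x) :=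
    Filter.Eventually.of_forall fun z => (exp_pos _).le
  refine ⟨⟨hmeas, ?_⟩, ?_⟩
  · rw [hasFiniteIntegral_iff_ofReal hpos, hl]
    exact ENNReal.ofReal_lt_top
  · rw [integral_eq_lintegral_of_nonneg_ae hpos hmeas, hl, ENNReal.toReal_ofReal]
    simpa using (hF 0 x hx).2

theorem hasAlternatingDerivs_iteratedDerivWithin {f : ℝ → ℝ}
    (hf : ContDiffOn ℝ (⊤ : ℕ∞) f (Ioi 0))
    (hs : ∀ (n : ℕ) (x : ℝ), 0 < x → 0 ≤ (-1 : ℝ) ^ n * iteratedDerivWithin n f (Ioi 0) x) :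
    HasAlternatingDerivs fun n => iteratedDerivWithin n f (Ioi 0) := by
  refine fun n x hx => ⟨?_, hs n x hx⟩
  have hd := hf.differentiableOn_iteratedDerivWithin (m := n)
    (by exact_mod_cast ENat.natCast_lt_top n) (uniqueDiffOn_Ioi 0) x hx
  simp only [iteratedDerivWithin_succ]
  exact hd.hasDerivWithinAt.hasDerivAt (Ioi_mem_nhds hx)

theorem laplace_transform_contDiffOn_and_alternating {f : ℝ → ℝ} {μ : Measure ℝ}
    (hμ : μ (Iio 0) = 0)
    (hf : ∀ x : ℝ, 0 < x → Integrable (fun z : ℝ => exp (-z * x)) μ ∧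
      f x = ∫ z : ℝ, exp (-z * x) ∂μ) :
    ContDiffOn ℝ (⊤ : ℕ∞) f (Ioi 0) ∧ ∀ (n : ℕ) (x : ℝ), 0 < x →
      0 ≤ (-1 : ℝ) ^ n * iteratedDerivWithin n f (Ioi 0) x := by
  have hsub : Ioi 0 ⊆ interior (ProbabilityTheory.integrableExpSet (fun z : ℝ => -z) μ) :=
    interior_maximal (fun x hx => by simpa [ProbabilityTheory.integrableExpSet, mul_comm] using
      (hf x hx).1) isOpen_Ioi
  have heq : EqOn f (ProbabilityTheory.mgf (fun z : ℝ => -z) μ) (Ioi 0) := fun x hx => by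
    simpa [ProbabilityTheory.mgf, mul_comm] using (hf x hx).2
  refine ⟨((ProbabilityTheory.analyticOn_mgf.mono hsub).contDiffOn
    (uniqueDiffOn_Ioi 0)).congr heq, fun n x hx => ?_⟩
  rw [iteratedDerivWithin_congr heq hx, iteratedDerivWithin_of_isOpen isOpen_Ioi hx,
    ProbabilityTheory.iteratedDeriv_mgf (hsub hx), ← integral_const_mul]
  have hae : ∀ᵐ z ∂μ, 0 ≤ z := by
    rw [ae_iff]
    simpa [← Iio_def] using! hμ
  refine integral_nonneg_of_ae ?_
  filter_upwards [hae] with z hz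
  rw [← mul_assoc, ← mul_pow, neg_one_mul, neg_neg]
  positivity

/-- **Bernstein's theorem.** A function `f : (0,∞) → ℝ` is completely monotone
(infinitely differentiable with `(-1)^n f^{(n)}(x) ≥ 0` for all `n ≥ 0`, `x > 0`)
if and only if it is the Laplace transform of a positive Borel measure on `[0,∞)`. -/
theorem bernstein_completely_monotone (f : ℝ → ℝ) :
    (ContDiffOn ℝ (⊤ : ℕ∞) f (Ioi 0) ∧
      ∀ (n : ℕ) (x : ℝ), 0 < x →
        0 ≤ (-1 : ℝ) ^ n * iteratedDerivWithin n f (Ioi 0) x) ↔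
    (∃ μ : Measure ℝ, μ (Iio 0) = 0 ∧
      ∀ x : ℝ, 0 < x →
        Integrable (fun z : ℝ => Real.exp (-z * x)) μ ∧
        f x = ∫ z : ℝ, Real.exp (-z * x) ∂μ) := by
  refine ⟨fun ⟨hf, hs⟩ => ?_, fun ⟨μ, hμ, hf⟩ =>
    laplace_transform_contDiffOn_and_alternating hμ hf⟩
  simpa only [iteratedDerivWithin_zero] using
    (hasAlternatingDerivs_iteratedDerivWithin hf hs).exists_measure
end

section
/- Let f(x) = Σ_{n≥1} a_n e^{-b_n x} for x > 0 and g(x) = Σ_{n≥1} c_n e^{d_n x} for x < 0, where a_n, c_n > 0, b_n, d_n > 0 strictly increasing to ∞, with Σ a_n/b_n < ∞ and Σ c_n/d_n < ∞, and assume {b_n} ∩ {d_n} = ∅. Then the convolution h(x) = ∫_ℝ f(y) 1_{y>0} g(x−y) 1_{x−y<0} dy, restricted to x > 0, is again an infinite series of decaying exponentials: h(x) = Σ_{n≥1} α_n e^{-b_n x} for x > 0 with α_n = a_n Σ_{m≥1} c_m/(b_n + d_m) > 0. -/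
open Real Set Filter MeasureTheory

theorem summable_mul_exp_neg_mul {a b : ℕ → ℝ} (ha : ∀ n, 0 ≤ a n) (hb : ∀ n, 0 < b n)
    (h : Summable fun n => a n / b n) {x : ℝ} (hx : 0 < x) :
    Summable fun n => a n * Real.exp (-(b n) * x) := by
  refine Summable.of_nonneg_of_le (fun n => mul_nonneg (ha n) (Real.exp_pos _).le) (fun n => ?_)
    (h.mul_right x⁻¹)
  have hbx : 0 < b n * x := mul_pos (hb n) hx
  have hexp : Real.exp (-(b n) * x) ≤ (b n * x)⁻¹ := by
    rw [neg_mul, Real.exp_neg]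
    exact inv_anti₀ hbx (by linarith [Real.add_one_le_exp (b n * x)])
  calc a n * Real.exp (-(b n) * x) ≤ a n * (b n * x)⁻¹ :=
        mul_le_mul_of_nonneg_left hexp (ha n)
    _ = a n / b n * x⁻¹ := by rw [mul_inv, div_eq_mul_inv, mul_assoc]

theorem exp_neg_mul_mul_exp_mul_sub (β δ x y : ℝ) :
    Real.exp (-β * y) * Real.exp (δ * (x - y)) =
      Real.exp (δ * x) * Real.exp (-(β + δ) * y) := by
  rw [← Real.exp_add, ← Real.exp_add]
  ring_nf

theorem integral_exp_neg_mul_mul_exp_Ioi {β δ : ℝ} (h : 0 < β + δ) (x : ℝ) :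
    ∫ y in Ioi x, Real.exp (-β * y) * Real.exp (δ * (x - y)) =
      Real.exp (-β * x) / (β + δ) := by
  simp_rw [exp_neg_mul_mul_exp_mul_sub]
  rw [integral_const_mul, integral_exp_mul_Ioi (by linarith), neg_div_neg_eq,
    ← mul_div_assoc, ← Real.exp_add]
  ring_nf

theorem integrableOn_exp_neg_mul_mul_exp_Ioi {β δ : ℝ} (h : 0 < β + δ) (x : ℝ) :
    IntegrableOn (fun y => Real.exp (-β * y) * Real.exp (δ * (x - y))) (Ioi x) := by
  simp_rw [exp_neg_mul_mul_exp_mul_sub]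
  exact (integrableOn_exp_mul_Ioi (by linarith) x).const_mul _

theorem summable_div_add {c d : ℕ → ℝ} (hc : ∀ m, 0 ≤ c m) (hd : ∀ m, 0 < d m)
    (h : Summable fun m => c m / d m) {β : ℝ} (hβ : 0 ≤ β) :
    Summable fun m => c m / (β + d m) :=
  h.of_nonneg_of_le (fun m => div_nonneg (hc m) (by linarith [hd m]))
    fun m => div_le_div_of_nonneg_left (hc m) (hd m) (by linarith)

/-- Convolution of one-sided exponential mixtures: if `f(x) = Σ aₙ e^{-bₙ x}` on `(0,∞)`
and `g(x) = Σ cₙ e^{dₙ x}` on `(-∞,0)` with integrable coefficients, then the restriction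
to `x > 0` of the convolution `h = (f 1_{(0,∞)}) * (g 1_{(-∞,0)})` is again a mixture of
decaying exponentials `h(x) = Σ αₙ e^{-bₙ x}` with `αₙ = aₙ Σ_m c_m/(bₙ + d_m) > 0`. -/
theorem convolution_of_exponential_mixtures
    (a c b d : ℕ → ℝ) (f g h : ℝ → ℝ)
    (ha : ∀ n, 0 < a n) (hc : ∀ n, 0 < c n)
    (hb : ∀ n, 0 < b n) (hd : ∀ n, 0 < d n)
    (hbmono : StrictMono b) (hdmono : StrictMono d)
    (hbtop : Tendsto b atTop atTop) (hdtop : Tendsto d atTop atTop)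
    (hdisj : ∀ n m, b n ≠ d m)
    (hsumab : Summable (fun n => a n / b n)) (hsumcd : Summable (fun n => c n / d n))
    (hf : ∀ x : ℝ, 0 < x → f x = ∑' n, a n * Real.exp (-(b n) * x))
    (hg : ∀ x : ℝ, x < 0 → g x = ∑' n, c n * Real.exp (d n * x))
    (hh : ∀ x : ℝ, h x =
      ∫ y : ℝ, (Set.indicator (Ioi 0) f y) * (Set.indicator (Iio 0) g (x - y))) :
    ∀ x : ℝ, 0 < x →
      (∀ n, 0 < a n * ∑' m, c m / (b n + d m)) ∧
      h x = ∑' n, (a n * ∑' m, c m / (b n + d m)) * Real.exp (-(b n) * x) := by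
  intro x hx
  have hbd : ∀ n m, 0 < b n + d m := fun n m => add_pos (hb n) (hd m)
  refine ⟨fun n => mul_pos (ha n) ((summable_div_add (fun m => (hc m).le) hd hsumcd
    (hb n).le).tsum_pos (fun m => (div_pos (hc m) (hbd n m)).le) 0
    (div_pos (hc 0) (hbd n 0))), ?_⟩
  let F : ℕ × ℕ → ℝ → ℝ := fun p y =>
    (a p.1 * c p.2) * (Real.exp (-(b p.1) * y) * Real.exp (d p.2 * (x - y)))
  have hFnonneg : ∀ p y, 0 ≤ F p y := fun p y =>
    mul_nonneg (mul_pos (ha _) (hc _)).le (mul_pos (Real.exp_pos _) (Real.exp_pos _)).le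
  have hFint : ∀ p, Integrable (F p) (volume.restrict (Ioi x)) := fun p =>
    (integrableOn_exp_neg_mul_mul_exp_Ioi (hbd p.1 p.2) x).const_mul _
  have hFval : ∀ p : ℕ × ℕ, ∫ y in Ioi x, F p y =
      a p.1 * Real.exp (-(b p.1) * x) * (c p.2 / (b p.1 + d p.2)) := fun p => by
    simp only [F]
    rw [integral_const_mul, integral_exp_neg_mul_mul_exp_Ioi (hbd p.1 p.2)]
    ring
  have hsum : Summable fun p : ℕ × ℕ =>
      a p.1 * Real.exp (-(b p.1) * x) * (c p.2 / (b p.1 + d p.2)) := by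
    have hax := summable_mul_exp_neg_mul (fun n => (ha n).le) hb hsumab hx
    refine (hax.mul_of_nonneg hsumcd (fun n => (mul_pos (ha n) (Real.exp_pos _)).le)
      (fun m => (div_pos (hc m) (hd m)).le)).of_nonneg_of_le (fun p => ?_) (fun p => ?_)
    · exact (mul_pos (mul_pos (ha _) (Real.exp_pos _)) (div_pos (hc _) (hbd _ _))).le
    · exact mul_le_mul_of_nonneg_left
        (div_le_div_of_nonneg_left (hc _).le (hd _) (by linarith [hb p.1]))
        (mul_pos (ha _) (Real.exp_pos _)).le
  have hswap : ∑' p, ∫ y in Ioi x, F p y = ∫ y in Ioi x, ∑' p, F p y := by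
    refine integral_tsum_of_summable_integral_norm hFint ?_
    simpa only [Real.norm_of_nonneg (hFnonneg _ _), hFval] using hsum
  have hprod : ∀ y ∈ Ioi x, f y * g (x - y) = ∑' p, F p y := fun y hy => by
    have hxy : x < y := hy
    have hfy := summable_mul_exp_neg_mul (fun n => (ha n).le) hb hsumab (hx.trans hxy)
    have hgy : Summable fun m => c m * Real.exp (d m * (x - y)) := by
      simpa [neg_mul, ← mul_neg] using
        summable_mul_exp_neg_mul (fun m => (hc m).le) hd hsumcd (sub_pos.2 hxy)
    rw [hf y (hx.trans hxy), hg (x - y) (sub_neg.2 hxy),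
      tsum_mul_tsum_of_summable_norm hfy.norm hgy.norm]
    exact tsum_congr fun p => by simp only [F]; ring
  have hind : (fun y => Set.indicator (Ioi 0) f y * Set.indicator (Iio 0) g (x - y)) =
      Set.indicator (Ioi x) fun y => f y * g (x - y) := by
    funext y
    rcases lt_or_ge x y with hxy | hxy
    · simp [hxy, hx.trans hxy]
    · simp [hxy.not_gt]
  rw [hh, hind, integral_indicator measurableSet_Ioi,
    setIntegral_congr_fun measurableSet_Ioi hprod, ← hswap, tsum_congr hFval, hsum.tsum_prod]
  refine tsum_congr fun n => ?_
  dsimp only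
  rw [tsum_mul_left]
  ring
end

section
/- Let ζ_1 < ρ_1 < ζ_2 < ρ_2 < ... be interlacing positive sequences and a_n, b_j the partial-fraction coefficients of φ and 1/φ as in Lemma 1 of the paper; let ρ̂_i > 0. For j ≥ 1 assume Σ_{k≥1} a_k ζ_k/(ρ_j − ζ_k) · e^{−aζ_k} terms converge absolutely for a > 0. Then h_{0,j} := b_j Σ_{k≥1} a_k ζ_k e^{−aζ_k}/(ρ_j − ζ_k) > 0 for all a > 0, because ρ_j Σ_{k≥1} a_k ζ_k e^{−xζ_k}/(ρ_j − ζ_k) is the probability density of the independent sum e(ρ_j) + \overline{X}_{e(q)}, where e(ρ_j) is Exp(ρ_j) and \overline{X}_{e(q)} has Laplace transform φ. -/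
open MeasureTheory ProbabilityTheory Real Filter Set Finset

theorem integrable_exp_neg_mul_of_nonneg {μ : Measure ℝ} [IsFiniteMeasure μ]
    (hμ : μ (Iio 0) = 0) {z : ℝ} (hz : 0 ≤ z) :
    Integrable (fun x => Real.exp (-z * x)) μ := by
  refine Integrable.of_bound (by fun_prop) 1 ?_
  have h : ∀ᵐ x ∂μ, 0 ≤ x := by simpa [ae_iff, Iio_def] using hμ
  filter_upwards [h] with x hx
  rw [Real.norm_eq_abs, Real.abs_exp, Real.exp_le_one_iff]
  nlinarith

theorem Iio_subset_interior_integrableExpSet {μ : Measure ℝ} [IsFiniteMeasure μ]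
    (hμ : μ (Iio 0) = 0) : Set.Iio 0 ⊆ interior (integrableExpSet id μ) := by
  refine interior_maximal (fun t ht => ?_) isOpen_Iio
  simpa [integrableExpSet] using
    integrable_exp_neg_mul_of_nonneg hμ (z := -t) (neg_nonneg.2 (le_of_lt ht))

theorem tendsto_complexMGF_neg_one_div_add {μ : Measure ℝ} [IsFiniteMeasure μ]
    (hμ : μ (Iio 0) = 0) (t : ℝ) :
    Tendsto (fun n : ℕ => complexMGF id μ (-(1 / ((n : ℝ) + 1) : ℝ) + t * Complex.I)) atTop
      (nhds (complexMGF id μ (t * Complex.I))) := by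
  have h : ∀ᵐ x ∂μ, 0 ≤ x := by simpa [ae_iff, Iio_def] using hμ
  refine tendsto_integral_of_dominated_convergence (fun _ => 1)
    (fun n => by fun_prop) (integrable_const 1) (fun n => ?_) (Eventually.of_forall fun x => ?_)
  · filter_upwards [h] with x hx
    rw [Complex.norm_exp, Real.exp_le_one_iff]
    have : 0 ≤ 1 / ((n : ℝ) + 1) := by positivity
    have h2 : ((-(1 / ((n : ℝ) + 1) : ℝ) + t * Complex.I : ℂ) * (id x : ℝ)).re
        = -(1 / ((n : ℝ) + 1)) * x := by
      rw [Complex.re_mul_ofReal, Complex.add_re, Complex.neg_re, Complex.ofReal_re,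
        Complex.re_ofReal_mul, Complex.I_re, mul_zero, add_zero, id_eq]
    rw [h2]
    nlinarith
  · have h1 : Tendsto (fun n : ℕ => ((1 / ((n : ℝ) + 1) : ℝ) : ℂ)) atTop (nhds 0) := by
      exact_mod_cast (Complex.continuous_ofReal.tendsto 0).comp
        (tendsto_one_div_add_atTop_nhds_zero_nat (𝕜 := ℝ))
    have h2 := ((h1.neg.add_const (t * Complex.I)).mul_const (x : ℂ)).cexp
    simpa using h2

/-- A finite measure on `[0, ∞)` is determined by its Laplace transform. -/
theorem ext_of_integral_exp_neg_mul_eq {μ ν : Measure ℝ} [IsFiniteMeasure μ] [IsFiniteMeasure ν]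
    (hμ : μ (Iio 0) = 0) (hν : ν (Iio 0) = 0)
    (h : ∀ z : ℝ, 0 < z → ∫ x, Real.exp (-z * x) ∂μ = ∫ x, Real.exp (-z * x) ∂ν) : μ = ν := by
  have hset : IsPreconnected {z : ℂ | z.re < 0} := (convex_halfSpace_re_lt 0).isPreconnected
  have hana {κ : Measure ℝ} [IsFiniteMeasure κ] (hκ : κ (Iio 0) = 0) :
      AnalyticOnNhd ℂ (complexMGF id κ) {z : ℂ | z.re < 0} :=
    analyticOnNhd_complexMGF.mono fun z hz => Iio_subset_interior_integrableExpSet hκ hz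
  have heq : EqOn (complexMGF id μ) (complexMGF id ν) {z : ℂ | z.re < 0} := by
    refine AnalyticOnNhd.eqOn_of_preconnected_of_frequently_eq (hana hμ) (hana hν) hset
      (z₀ := ((-1 : ℝ) : ℂ)) (by simp) ?_
    have h_real : ∃ᶠ x : ℝ in nhdsWithin (-1) {-1}ᶜ,
        complexMGF id μ x = complexMGF id ν x := by
      refine Eventually.frequently (eventually_nhdsWithin_of_eventually_nhds ?_)
      filter_upwards [Iio_mem_nhds (show (-1 : ℝ) < 0 by norm_num)] with y hy
      rw [complexMGF_ofReal, complexMGF_ofReal]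
      simpa [mgf] using congrArg (fun r : ℝ => (r : ℂ)) (h (-y) (neg_pos.2 hy))
    rw [frequently_iff_seq_forall] at h_real ⊢
    obtain ⟨xs, hx_tendsto, hx_eq⟩ := h_real
    refine ⟨fun n => xs n, ?_, fun n => hx_eq n⟩
    rw [tendsto_nhdsWithin_iff] at hx_tendsto ⊢
    refine ⟨(Complex.continuous_ofReal.tendsto _).comp hx_tendsto.1, ?_⟩
    filter_upwards [hx_tendsto.2] with n hn hn'
    exact hn (Complex.ofReal_injective hn')
  refine Measure.ext_of_charFun (funext fun t => ?_)
  rw [← complexMGF_id_mul_I, ← complexMGF_id_mul_I]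
  refine tendsto_nhds_unique (tendsto_complexMGF_neg_one_div_add hμ t) ?_
  refine (tendsto_complexMGF_neg_one_div_add hν t).congr fun n => (heq ?_).symm
  have : 0 < ((n : ℝ) + 1)⁻¹ := by positivity
  rw [Set.mem_ofPred_eq, ← Complex.ofReal_neg, Complex.add_re, Complex.ofReal_re]
  simpa using this

theorem withDensity_ofReal_indicator_Ici_Iio (g : ℝ → ℝ) :
    volume.withDensity (fun x => ENNReal.ofReal (Set.indicator (Ici (0 : ℝ)) g x)) (Iio 0) = 0 := by
  rw [withDensity_apply _ measurableSet_Iio, setLIntegral_congr_fun measurableSet_Iio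
    (g := fun _ => 0) (fun x hx => by simp [Set.indicator, not_le.2 (mem_Iio.1 hx)])]
  simp

theorem integral_exp_neg_mul_withDensity {g : ℝ → ℝ} (hg : IntegrableOn g (Ioi 0))
    (hg0 : ∀ x, 0 < x → 0 ≤ g x) (z : ℝ) :
    ∫ x, Real.exp (-z * x) ∂(volume.withDensity
      (fun x => ENNReal.ofReal (Set.indicator (Ici (0 : ℝ)) g x))) =
      ∫ x in Ioi 0, Real.exp (-z * x) * g x := by
  have hint : Integrable (Set.indicator (Ici (0 : ℝ)) g) :=
    (integrable_indicator_iff measurableSet_Ici).2 ((integrableOn_Ici_iff_integrableOn_Ioi).2 hg)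
  rw [integral_withDensity_eq_integral_toReal_smul₀ hint.aemeasurable.ennreal_ofReal
    (by simp), ← integral_Ici_eq_integral_Ioi, ← integral_indicator measurableSet_Ici]
  refine integral_congr_ae ?_
  filter_upwards [volume.ae_ne 0] with x hx
  by_cases h : 0 ≤ x
  · simp [h, ENNReal.toReal_ofReal (hg0 x (lt_of_le_of_ne h hx.symm)), mul_comm]
  · simp [h]

theorem isFiniteMeasure_withDensity_indicator_Ici {g : ℝ → ℝ} (hg : IntegrableOn g (Ioi 0)) :
    IsFiniteMeasure (volume.withDensity
      (fun x => ENNReal.ofReal (Set.indicator (Ici (0 : ℝ)) g x))) :=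
  isFiniteMeasure_withDensity_ofReal <| Integrable.hasFiniteIntegral <|
    (integrable_indicator_iff measurableSet_Ici).2 ((integrableOn_Ici_iff_integrableOn_Ioi).2 hg)

theorem expMeasure_eq_withDensity (r : ℝ) :
    expMeasure r = volume.withDensity (fun x => ENNReal.ofReal
      (Set.indicator (Ici (0 : ℝ)) (fun y => r * Real.exp (-r * y)) x)) := by
  change volume.withDensity (exponentialPDF r) = _
  congr 1
  ext x
  simp [exponentialPDF_eq, Set.indicator]

theorem integral_Ioi_exp_neg_mul {r : ℝ} (hr : 0 < r) :
    ∫ x in Ioi (0 : ℝ), Real.exp (-r * x) = 1 / r := by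
  rw [integral_exp_mul_Ioi (neg_lt_zero.2 hr)]
  simp

theorem integral_exp_neg_mul_expMeasure {r z : ℝ} (hr : 0 < r) (hz : 0 ≤ z) :
    ∫ x, Real.exp (-z * x) ∂(expMeasure r) = r / (r + z) := by
  rw [expMeasure_eq_withDensity, integral_exp_neg_mul_withDensity
    ((exp_neg_integrableOn_Ioi 0 hr).const_mul r) (fun x _ => by positivity)]
  have (x : ℝ) : Real.exp (-z * x) * (r * Real.exp (-r * x)) = r * Real.exp (-(r + z) * x) := by
    rw [mul_left_comm, ← Real.exp_add]
    ring_nf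
  simp_rw [this]
  rw [integral_const_mul, integral_Ioi_exp_neg_mul (by positivity)]
  ring

theorem integral_exp_neg_mul_tsum {w ζ : ℕ → ℝ} (hζ : ∀ k, 0 < ζ k)
    (hw : Summable fun k => |w k| / ζ k) {z : ℝ} (hz : 0 ≤ z) :
    ∫ x in Ioi (0 : ℝ), Real.exp (-z * x) * ∑' k, w k * Real.exp (-ζ k * x) =
      ∑' k, w k / (ζ k + z) := by
  have hpos (k : ℕ) : 0 < ζ k + z := add_pos_of_pos_of_nonneg (hζ k) hz
  have hF : ∀ k, ∫ x in Ioi (0 : ℝ), w k * Real.exp (-(ζ k + z) * x) = w k / (ζ k + z) := by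
    intro k
    rw [integral_const_mul, integral_Ioi_exp_neg_mul (hpos k), mul_one_div]
  have hsum := hasSum_integral_of_summable_integral_norm (μ := volume.restrict (Ioi (0 : ℝ)))
    (F := fun k x => w k * Real.exp (-(ζ k + z) * x))
    (fun k => (exp_neg_integrableOn_Ioi 0 (hpos k)).const_mul (w k)) (by
      refine hw.of_nonneg_of_le (fun k => integral_nonneg fun x => norm_nonneg _) fun k => ?_
      simp_rw [norm_mul, Real.norm_eq_abs, Real.abs_exp]
      rw [integral_const_mul, integral_Ioi_exp_neg_mul (hpos k), mul_one_div]
      exact div_le_div_of_nonneg_left (abs_nonneg _) (hζ k) (by linarith))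
  simp_rw [hF] at hsum
  rw [hsum.tsum_eq]
  refine integral_congr_ae (Eventually.of_forall fun x => ?_)
  dsimp only
  rw [← tsum_mul_left]
  refine tsum_congr fun k => ?_
  rw [mul_left_comm, ← Real.exp_add]
  ring_nf

theorem integral_exp_neg_mul_map_add {μ ν : Measure ℝ} [IsFiniteMeasure μ] [IsFiniteMeasure ν]
    (z : ℝ) :
    ∫ x, Real.exp (-z * x) ∂(Measure.map (fun p : ℝ × ℝ => p.1 + p.2) (ν.prod μ)) =
      (∫ x, Real.exp (-z * x) ∂ν) * ∫ x, Real.exp (-z * x) ∂μ := by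
  rw [integral_map (by fun_prop) (by fun_prop), ← integral_prod_mul]
  simp_rw [← Real.exp_add, mul_add]

theorem map_add_prod_Iio_eq_zero {μ ν : Measure ℝ} [IsFiniteMeasure μ] [IsFiniteMeasure ν]
    (hμ : μ (Iio 0) = 0) (hν : ν (Iio 0) = 0) :
    Measure.map (fun p : ℝ × ℝ => p.1 + p.2) (ν.prod μ) (Iio 0) = 0 := by
  rw [Measure.map_apply (by fun_prop) measurableSet_Iio]
  refine measure_mono_null (t := Set.Iio 0 ×ˢ Set.univ ∪ Set.univ ×ˢ Set.Iio 0) (fun p hp => ?_) ?_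
  · simp only [Set.mem_union, Set.mem_prod, Set.mem_Iio, Set.mem_univ, and_true, true_and]
    by_contra! h
    exact absurd (Set.mem_Iio.1 (mem_preimage.1 hp)) (not_lt.2 (add_nonneg h.1 h.2))
  · simp [Measure.prod_prod, hμ, hν, measure_union_null]

/-- The residue coefficient at `ζ k` of the rational function
`∏_{n < N} (1 - x / ρ n) / (1 - x / ζ n)`. -/
noncomputable def truncatedCoeff (ρ ζ : ℕ → ℝ) (N k : ℕ) : ℝ :=
  (1 - ζ k / ρ k) * ∏ n ∈ (range N).erase k, (1 - ζ k / ρ n) / (1 - ζ k / ζ n)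

theorem truncatedCoeff_succ (ρ ζ : ℕ → ℝ) {N k : ℕ} (h : k < N) :
    truncatedCoeff ρ ζ (N + 1) k =
      truncatedCoeff ρ ζ N k * ((1 - ζ k / ρ N) / (1 - ζ k / ζ N)) := by
  rw [truncatedCoeff, truncatedCoeff, range_add_one, erase_insert_of_ne h.ne',
    prod_insert (by simp)]
  ring

theorem truncatedCoeff_succ_self (ρ ζ : ℕ → ℝ) (N : ℕ) :
    truncatedCoeff ρ ζ (N + 1) N =
      (1 - ζ N / ρ N) * ∏ n ∈ range N, (1 - ζ N / ρ n) / (1 - ζ N / ζ n) := by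
  rw [truncatedCoeff, range_add_one, erase_insert (by simp)]

theorem prod_eq_sum_truncatedCoeff {ρ ζ : ℕ → ℝ} (hρ : ∀ n, ρ n ≠ 0) (hζ : ∀ n, ζ n ≠ 0)
    (hinj : Function.Injective ζ) (N : ℕ) {x : ℝ} (hx : ∀ n < N, ζ n ≠ x) :
    ∏ n ∈ range N, (1 - x / ρ n) / (1 - x / ζ n) =
      ∏ n ∈ range N, ζ n / ρ n +
        ∑ k ∈ range N, truncatedCoeff ρ ζ N k * (ζ k / (ζ k - x)) := by
  induction N generalizing x with
  | zero => simp
  | succ N ih =>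
    have hN : ∀ n < N, ζ n ≠ ζ N := fun n hn h => hn.ne (hinj h)
    have hxN : ζ N - x ≠ 0 := sub_ne_zero.2 (hx N N.lt_succ_self)
    have hρN := hρ N
    have hζN := hζ N
    have hden : 1 - x / ζ N ≠ 0 := by
      rw [one_sub_div hζN]
      exact div_ne_zero hxN hζN
    have hr : (1 - x / ρ N) / (1 - x / ζ N) =
        ζ N / ρ N + (1 - ζ N / ρ N) * (ζ N / (ζ N - x)) := by
      rw [one_sub_div hζN]
      field_simp
      ring
    have hk : ∀ k ∈ range N, truncatedCoeff ρ ζ (N + 1) k * (ζ k / (ζ k - x)) =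
        truncatedCoeff ρ ζ N k * (ζ k / (ζ k - x)) * ((1 - x / ρ N) / (1 - x / ζ N)) -
        (1 - ζ N / ρ N) * (ζ N / (ζ N - x)) *
          (truncatedCoeff ρ ζ N k * (ζ k / (ζ k - ζ N))) := by
      intro k hk
      have hk := Finset.mem_range.1 hk
      have h1 : ζ k - x ≠ 0 := sub_ne_zero.2 (hx k (hk.trans N.lt_succ_self))
      have h2 : ζ k - ζ N ≠ 0 := sub_ne_zero.2 (hN k hk)
      have h3 : ζ N - ζ k ≠ 0 := sub_ne_zero.2 (hN k hk).symm
      rw [truncatedCoeff_succ ρ ζ hk, hr, one_sub_div hζN]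
      field_simp
      ring
    rw [prod_range_succ, prod_range_succ, sum_range_succ, sum_congr rfl hk, sum_sub_distrib,
      ← sum_mul, ← mul_sum, truncatedCoeff_succ_self, ih hN,
      ih fun n hn => hx n (hn.trans N.lt_succ_self), add_mul, hr]
    ring

theorem tendsto_prod_erase_and_tprod_pos {f : ℕ → ℝ} (n : ℕ) (hf : ∀ k, k ≠ n → 0 < f k)
    (hsum : Summable fun k => f k - 1) :
    Tendsto (fun N => ∏ k ∈ (range N).erase n, f k) atTop
      (nhds (∏' k : {k : ℕ // k ≠ n}, f k)) ∧ 0 < ∏' k : {k : ℕ // k ≠ n}, f k := by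
  set g := Set.mulIndicator {k | k ≠ n} f with hg
  have hgn : g n = 1 := by simp [hg]
  have hgk {k : ℕ} (hk : k ≠ n) : g k = f k := by simp [hg, hk]
  have hg0 (k : ℕ) : 0 < g k := by
    by_cases hk : k = n
    · rw [hk, hgn]; exact one_pos
    · rw [hgk hk]; exact hf k hk
  have hgs : Summable fun k => g k - 1 := by
    refine (hsum.indicator {k | k ≠ n}).congr fun k => ?_
    by_cases hk : k = n
    · simp [hk, hgn]
    · simp [hk, hgk hk]
  have hlog : Summable fun k => Real.log (g k) := by
    simpa using Real.summable_log_one_add_of_summable hgs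
  have htp : ∏' k : {k : ℕ // k ≠ n}, f k = ∏' k, g k := tprod_subtype {k | k ≠ n} f
  rw [htp]
  refine ⟨?_, ?_⟩
  · refine (Real.multipliable_of_summable_log hg0 hlog).hasProd.tendsto_prod_nat.congr fun N => ?_
    rw [← Finset.prod_erase _ hgn]
    exact Finset.prod_congr rfl fun k hk => hgk (Finset.ne_of_mem_erase hk)
  · rw [← Real.rexp_tsum_eq_tprod hg0 hlog]
    exact Real.exp_pos _

theorem summable_div_sub_one {p q : ℕ → ℝ} (hpq : Summable fun n => (p n)⁻¹ - (q n)⁻¹)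
    (hq : Tendsto q atTop atTop) (x : ℝ) :
    Summable fun n => (1 - x / p n) / (1 - x / q n) - 1 := by
  have hlim : Tendsto (fun n => 1 - x / q n) atTop (nhds 1) := by
    simpa using (tendsto_const_nhds (x := x)).div_atTop hq |>.const_sub 1
  refine Summable.of_norm_bounded_eventually_nat (hpq.norm.mul_left (2 * |x|)) ?_
  filter_upwards [hlim.eventually_const_lt (show (1 / 2 : ℝ) < 1 by norm_num)] with n hn
  have hne : 1 - x / q n ≠ 0 := by linarith
  have heq : (1 - x / p n) / (1 - x / q n) - 1 =
      -(x * ((p n)⁻¹ - (q n)⁻¹) / (1 - x / q n)) := by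
    rw [div_sub_one hne, ← neg_div]
    congr 1
    ring
  rw [heq, norm_neg, norm_div, norm_mul, Real.norm_eq_abs, Real.norm_eq_abs (1 - x / q n),
    abs_of_pos (by linarith : 0 < 1 - x / q n), div_le_iff₀ (by linarith)]
  nlinarith [mul_nonneg (abs_nonneg x) (norm_nonneg ((p n)⁻¹ - (q n)⁻¹))]

/-- The sequences `ζ 0 < ρ 0 < ζ 1 < ρ 1 < ⋯` are positive, interlacing and unbounded. -/
structure Interlacing (ρ ζ : ℕ → ℝ) : Prop where
  pos : ∀ n, 0 < ζ n
  lt : ∀ n, ζ n < ρ n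
  lt_succ : ∀ n, ρ n < ζ (n + 1)
  tendsto : Tendsto ρ atTop atTop

namespace Interlacing

variable {ρ ζ : ℕ → ℝ}

theorem strictMono (h : Interlacing ρ ζ) : StrictMono ζ :=
  strictMono_nat_of_lt_succ fun n => (h.lt n).trans (h.lt_succ n)

theorem pos' (h : Interlacing ρ ζ) (n : ℕ) : 0 < ρ n := (h.pos n).trans (h.lt n)

theorem lt_of_le (h : Interlacing ρ ζ) {m n : ℕ} (hmn : m ≤ n) : ζ m < ρ n :=
  (h.strictMono.monotone hmn).trans_lt (h.lt n)

theorem lt_of_lt (h : Interlacing ρ ζ) {m n : ℕ} (hmn : m < n) : ρ m < ζ n :=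
  (h.lt_succ m).trans_le (h.strictMono.monotone hmn)

theorem ne (h : Interlacing ρ ζ) (m n : ℕ) : ζ m ≠ ρ n := by
  rcases le_or_gt m n with hmn | hmn
  · exact (h.lt_of_le hmn).ne
  · exact (h.lt_of_lt hmn).ne'

theorem tendsto' (h : Interlacing ρ ζ) : Tendsto ζ atTop atTop :=
  (tendsto_add_atTop_iff_nat 1).1 (tendsto_atTop_mono (fun n => (h.lt_succ n).le) h.tendsto)

theorem summable_inv_sub_inv (h : Interlacing ρ ζ) : Summable fun n => (ζ n)⁻¹ - (ρ n)⁻¹ := by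
  refine summable_of_sum_range_le (c := (ζ 0)⁻¹)
    (fun n => sub_nonneg.2 (inv_anti₀ (h.pos n) (h.lt n).le)) fun N => ?_
  have hN : ∑ n ∈ range N, ((ζ n)⁻¹ - (ρ n)⁻¹) ≤ (ζ 0)⁻¹ - (ζ N)⁻¹ := by
    induction N with
    | zero => simp
    | succ N ih =>
      rw [sum_range_succ]
      linarith [inv_anti₀ (h.pos' N) (h.lt_succ N).le]
  linarith [inv_pos.2 (h.pos N)]

theorem summable_factor_sub_one (h : Interlacing ρ ζ) (x : ℝ) :
    Summable fun n => (1 - x / ρ n) / (1 - x / ζ n) - 1 :=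
  summable_div_sub_one (by simpa using h.summable_inv_sub_inv.neg) h.tendsto' x

theorem factor_pos (h : Interlacing ρ ζ) {k n : ℕ} (hkn : n ≠ k) :
    0 < (1 - ζ k / ρ n) / (1 - ζ k / ζ n) := by
  rcases hkn.lt_or_gt with hlt | hlt
  · exact div_pos_of_neg_of_neg (sub_neg.2 ((one_lt_div (h.pos' n)).2 (h.lt_of_lt hlt)))
      (sub_neg.2 ((one_lt_div (h.pos n)).2 (h.strictMono hlt)))
  · exact div_pos (sub_pos.2 ((div_lt_one (h.pos' n)).2 (h.lt_of_le hlt.le)))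
      (sub_pos.2 ((div_lt_one (h.pos n)).2 (h.strictMono hlt)))

theorem one_le_factor (h : Interlacing ρ ζ) {k n : ℕ} (hkn : k < n) :
    1 ≤ (1 - ζ k / ρ n) / (1 - ζ k / ζ n) := by
  rw [one_le_div (sub_pos.2 ((div_lt_one (h.pos n)).2 (h.strictMono hkn)))]
  linarith [div_le_div_of_nonneg_left (h.pos k).le (h.pos n) (h.lt n).le]

theorem reciprocal_coeff_pos (h : Interlacing ρ ζ) (n : ℕ) :
    0 < -(1 - ρ n / ζ n) *
      ∏' k : {k : ℕ // k ≠ n}, (1 - ρ n / ζ (k : ℕ)) / (1 - ρ n / ρ (k : ℕ)) := by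
  refine mul_pos (by linarith [(one_lt_div (h.pos n)).2 (h.lt n)])
    (tendsto_prod_erase_and_tprod_pos (f := fun k => (1 - ρ n / ζ k) / (1 - ρ n / ρ k)) n
      (fun k hk => ?_) (summable_div_sub_one h.summable_inv_sub_inv h.tendsto _)).2
  have hρ {i j : ℕ} (hij : i < j) : ρ i < ρ j := (h.lt_of_lt hij).trans (h.lt j)
  rcases hk.lt_or_gt with hlt | hlt
  · exact div_pos_of_neg_of_neg (sub_neg.2 ((one_lt_div (h.pos k)).2 (h.lt_of_le hlt.le)))
      (sub_neg.2 ((one_lt_div (h.pos' k)).2 (hρ hlt)))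
  · exact div_pos (sub_pos.2 ((div_lt_one (h.pos k)).2 (h.lt_of_lt hlt)))
      (sub_pos.2 ((div_lt_one (h.pos' k)).2 (hρ hlt)))

theorem truncatedCoeff_pos (h : Interlacing ρ ζ) (N k : ℕ) : 0 < truncatedCoeff ρ ζ N k :=
  mul_pos (sub_pos.2 ((div_lt_one (h.pos' k)).2 (h.lt k)))
    (Finset.prod_pos fun _ hn => h.factor_pos (Finset.ne_of_mem_erase hn))

theorem truncatedCoeff_mono (h : Interlacing ρ ζ) {k M N : ℕ} (hk : k < M) (hMN : M ≤ N) :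
    truncatedCoeff ρ ζ M k ≤ truncatedCoeff ρ ζ N k := by
  induction N, hMN using Nat.le_induction with
  | base => exact le_rfl
  | succ N hMN ih =>
    rw [truncatedCoeff_succ ρ ζ (hk.trans_le hMN)]
    exact ih.trans (le_mul_of_one_le_right (h.truncatedCoeff_pos N k).le
      (h.one_le_factor (hk.trans_le hMN)))

/-- The residue coefficients of `∏ n, (1 - x / ρ n) / (1 - x / ζ n)`. -/
noncomputable def coeff (ρ ζ : ℕ → ℝ) (n : ℕ) : ℝ :=
  (1 - ζ n / ρ n) *
    ∏' k : {k : ℕ // k ≠ n}, (1 - ζ n / ρ (k : ℕ)) / (1 - ζ n / ζ (k : ℕ))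

theorem tendsto_truncatedCoeff (h : Interlacing ρ ζ) (k : ℕ) :
    Tendsto (fun N => truncatedCoeff ρ ζ N k) atTop (nhds (coeff ρ ζ k)) :=
  (tendsto_prod_erase_and_tprod_pos (f := fun n => (1 - ζ k / ρ n) / (1 - ζ k / ζ n)) k
    (fun _ hn => h.factor_pos hn) (h.summable_factor_sub_one _)).1.const_mul _

theorem truncatedCoeff_le_coeff (h : Interlacing ρ ζ) {N k : ℕ} (hk : k < N) :
    truncatedCoeff ρ ζ N k ≤ coeff ρ ζ k :=
  ge_of_tendsto (h.tendsto_truncatedCoeff k) <| by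
    filter_upwards [eventually_ge_atTop N] with M hM using h.truncatedCoeff_mono hk hM

theorem coeff_pos (h : Interlacing ρ ζ) (k : ℕ) : 0 < coeff ρ ζ k :=
  (h.truncatedCoeff_pos (k + 1) k).trans_le (h.truncatedCoeff_le_coeff k.lt_succ_self)

theorem prod_add_sum_truncatedCoeff (h : Interlacing ρ ζ) (N : ℕ) :
    ∏ n ∈ range N, ζ n / ρ n + ∑ k ∈ range N, truncatedCoeff ρ ζ N k = 1 := by
  have := prod_eq_sum_truncatedCoeff (fun n => (h.pos' n).ne') (fun n => (h.pos n).ne')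
    h.strictMono.injective N (x := 0) fun n _ => (h.pos n).ne'
  simpa [div_self (h.pos _).ne'] using this.symm

theorem prod_div_pos (h : Interlacing ρ ζ) (N : ℕ) : 0 < ∏ n ∈ range N, ζ n / ρ n :=
  Finset.prod_pos fun n _ => div_pos (h.pos n) (h.pos' n)

theorem summable_coeff (h : Interlacing ρ ζ) : Summable (coeff ρ ζ) := by
  refine summable_of_sum_range_le (c := 1) (fun k => (h.coeff_pos k).le) fun M => ?_
  refine le_of_tendsto (tendsto_finsetSum (range M) fun k _ => h.tendsto_truncatedCoeff k) ?_
  filter_upwards [eventually_ge_atTop M] with N hN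
  have hsub : ∑ k ∈ range M, truncatedCoeff ρ ζ N k ≤ ∑ k ∈ range N, truncatedCoeff ρ ζ N k :=
    sum_le_sum_of_subset_of_nonneg (range_mono hN) fun k _ _ => (h.truncatedCoeff_pos N k).le
  linarith [h.prod_add_sum_truncatedCoeff N, h.prod_div_pos N]

theorem summable_coeff_mul (h : Interlacing ρ ζ) {f : ℕ → ℝ} {C : ℝ} (hf : ∀ k, |f k| ≤ C) :
    Summable fun k => coeff ρ ζ k * f k := by
  refine Summable.of_norm_bounded (h.summable_coeff.mul_right C) fun k => ?_
  rw [norm_mul, Real.norm_eq_abs, abs_of_pos (h.coeff_pos k), Real.norm_eq_abs]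
  exact mul_le_mul_of_nonneg_left (hf k) (h.coeff_pos k).le

theorem tendsto_sum_truncatedCoeff_mul (h : Interlacing ρ ζ) {f : ℕ → ℝ} {C : ℝ}
    (hf : ∀ k, |f k| ≤ C) :
    Tendsto (fun N => ∑ k ∈ range N, truncatedCoeff ρ ζ N k * f k) atTop
      (nhds (∑' k, coeff ρ ζ k * f k)) := by
  have key := tendsto_tsum_of_dominated_convergence (𝓕 := atTop)
    (f := fun N k => if k < N then truncatedCoeff ρ ζ N k * f k else 0)
    (g := fun k => coeff ρ ζ k * f k) (bound := fun k => coeff ρ ζ k * C)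
    (h.summable_coeff.mul_right C) (fun k => ?_) (Eventually.of_forall fun N k => ?_)
  · refine key.congr fun N => ?_
    rw [tsum_eq_sum (s := range N) fun k hk => if_neg (by simpa using hk)]
    exact sum_congr rfl fun k hk => if_pos (Finset.mem_range.1 hk)
  · refine ((h.tendsto_truncatedCoeff k).mul_const (f k)).congr' ?_
    filter_upwards [eventually_gt_atTop k] with N hN using (if_pos hN).symm
  · have hC : 0 ≤ C := (abs_nonneg _).trans (hf k)
    split_ifs with hk
    · rw [norm_mul, Real.norm_eq_abs, abs_of_pos (h.truncatedCoeff_pos N k), Real.norm_eq_abs]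
      exact mul_le_mul (h.truncatedCoeff_le_coeff hk) (hf k) (abs_nonneg _) (h.coeff_pos k).le
    · simpa using mul_nonneg (h.coeff_pos k).le hC

/-- The atom at zero, i.e. the value at infinity of `∏ n, (1 + z / ρ n) / (1 + z / ζ n)`. -/
theorem tendsto_prod_div (h : Interlacing ρ ζ) :
    Tendsto (fun N => ∏ n ∈ range N, ζ n / ρ n) atTop (nhds (1 - ∑' k, coeff ρ ζ k)) := by
  have := h.tendsto_sum_truncatedCoeff_mul (f := fun _ => 1) (C := 1) (by simp)
  simp only [mul_one] at this
  refine (this.const_sub 1).congr fun N => ?_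
  linarith [h.prod_add_sum_truncatedCoeff N]

theorem tsum_coeff_le_one (h : Interlacing ρ ζ) : ∑' k, coeff ρ ζ k ≤ 1 :=
  sub_nonneg.1 (ge_of_tendsto' h.tendsto_prod_div fun N => (h.prod_div_pos N).le)

theorem exists_abs_div_sub_le (h : Interlacing ρ ζ) (x : ℝ) :
    ∃ C, ∀ k, |ζ k / (ζ k - x)| ≤ C := by
  have hlim : Tendsto (fun k => ζ k / (ζ k - x)) atTop (nhds 1) := by
    have h1 : Tendsto (fun k => 1 + x / (ζ k - x)) atTop (nhds 1) := by
      simpa [sub_eq_add_neg] using ((tendsto_const_nhds (x := x)).div_atTop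
        (tendsto_atTop_add_const_right _ (-x) h.tendsto')).const_add 1
    refine h1.congr' ?_
    filter_upwards [h.tendsto'.eventually_gt_atTop x] with k hk
    have : ζ k - x ≠ 0 := by linarith
    field_simp
    ring
  obtain ⟨C, hC⟩ := (Metric.isBounded_range_of_tendsto _ hlim).exists_norm_le
  exact ⟨C, fun k => hC _ ⟨k, rfl⟩⟩

/-- Partial fraction expansion of the infinite product. -/
theorem tendsto_prod_factor (h : Interlacing ρ ζ) {x : ℝ} (hx : ∀ n, ζ n ≠ x) :
    Tendsto (fun N => ∏ n ∈ range N, (1 - x / ρ n) / (1 - x / ζ n)) atTop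
      (nhds (1 - ∑' k, coeff ρ ζ k + ∑' k, coeff ρ ζ k * (ζ k / (ζ k - x)))) := by
  obtain ⟨C, hC⟩ := h.exists_abs_div_sub_le x
  refine (h.tendsto_prod_div.add (h.tendsto_sum_truncatedCoeff_mul hC)).congr fun N => ?_
  exact (prod_eq_sum_truncatedCoeff (fun n => (h.pos' n).ne') (fun n => (h.pos n).ne')
    h.strictMono.injective N fun n _ => hx n).symm

theorem tprod_eq_tsum (h : Interlacing ρ ζ) {z : ℝ} (hz : 0 ≤ z) :
    ∏' n, (1 + z / ρ n) / (1 + z / ζ n) =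
      1 - ∑' k, coeff ρ ζ k + ∑' k, coeff ρ ζ k * (ζ k / (ζ k + z)) := by
  have hm := (Real.multipliable_one_add_of_summable
    (h.summable_factor_sub_one (-z))).hasProd.tendsto_prod_nat
  have := tendsto_nhds_unique hm (by
    simpa only [add_sub_cancel] using h.tendsto_prod_factor (x := -z)
      fun n => by linarith [h.pos n])
  simpa [neg_div] using this

/-- The product vanishes at `x = ρ j`. -/
theorem tsum_coeff_mul_div (h : Interlacing ρ ζ) (j : ℕ) :
    ∑' k, coeff ρ ζ k * (ζ k / (ρ j - ζ k)) = 1 - ∑' k, coeff ρ ζ k := by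
  have hlim := h.tendsto_prod_factor fun n => h.ne n j
  have hzero : Tendsto (fun N => ∏ n ∈ range N, (1 - ρ j / ρ n) / (1 - ρ j / ζ n)) atTop
      (nhds 0) := by
    refine tendsto_const_nhds.congr' ?_
    filter_upwards [eventually_gt_atTop j] with N hN
    exact (Finset.prod_eq_zero (Finset.mem_range.2 hN) (by simp [(h.pos' j).ne'])).symm
  have h0 := tendsto_nhds_unique hlim hzero
  have hneg : ∑' k, coeff ρ ζ k * (ζ k / (ρ j - ζ k)) =
      -∑' k, coeff ρ ζ k * (ζ k / (ζ k - ρ j)) := by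
    rw [← tsum_neg]
    refine tsum_congr fun k => ?_
    rw [← neg_sub (ζ k) (ρ j), div_neg, mul_neg]
  linarith

theorem summable_coeff_mul_div (h : Interlacing ρ ζ) (j : ℕ) :
    Summable fun k => coeff ρ ζ k * (ζ k / (ρ j - ζ k)) := by
  obtain ⟨C, hC⟩ := h.exists_abs_div_sub_le (ρ j)
  refine h.summable_coeff_mul (C := C) fun k => ?_
  rw [← neg_sub (ζ k) (ρ j), div_neg, abs_neg]
  exact hC k

theorem summable_abs_coeff_mul_div_div (h : Interlacing ρ ζ) (j : ℕ) :
    Summable fun k => |coeff ρ ζ k * (ζ k / (ρ j - ζ k))| / ζ k := by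
  refine ((h.summable_coeff_mul_div j).abs.mul_right (ζ 0)⁻¹).of_nonneg_of_le
    (fun k => div_nonneg (abs_nonneg _) (h.pos k).le) fun k => ?_
  rw [div_eq_mul_inv]
  exact mul_le_mul_of_nonneg_left
    (inv_anti₀ (h.pos 0) (h.strictMono.monotone k.zero_le)) (abs_nonneg _)

/-- Partial fraction expansion of the product multiplied by `ρ j / (ρ j + z)`. -/
theorem mul_tprod_eq_tsum (h : Interlacing ρ ζ) (j : ℕ) {z : ℝ} (hz : 0 ≤ z) :
    ρ j / (ρ j + z) * ∏' n, (1 + z / ρ n) / (1 + z / ζ n) =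
      ρ j * ∑' k, coeff ρ ζ k * (ζ k / (ρ j - ζ k)) / (ζ k + z) := by
  have hρ : 0 < ρ j + z := add_pos_of_pos_of_nonneg (h.pos' j) hz
  have hs : Summable fun k => coeff ρ ζ k * (ζ k / (ζ k + z)) := by
    obtain ⟨C, hC⟩ := h.exists_abs_div_sub_le (-z)
    exact h.summable_coeff_mul (C := C) fun k => by simpa using hC k
  rw [h.tprod_eq_tsum hz, ← h.tsum_coeff_mul_div j,
    ← (h.summable_coeff_mul_div j).tsum_add hs, div_mul_eq_mul_div, mul_div_assoc,
    ← tsum_div_const]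
  congr 1
  refine tsum_congr fun k => ?_
  have h1 : ρ j - ζ k ≠ 0 := sub_ne_zero.2 (h.ne k j).symm
  have h2 : ζ k + z ≠ 0 := (add_pos_of_pos_of_nonneg (h.pos k) hz).ne'
  field_simp
  ring

theorem tsum_coeff_mul_div_mul_exp_pos (h : Interlacing ρ ζ) (j : ℕ) {x : ℝ} (hx : 0 < x)
    (hs : Summable fun k => coeff ρ ζ k * (ζ k / (ρ j - ζ k)) * Real.exp (-ζ k * x)) :
    0 < ∑' k, coeff ρ ζ k * (ζ k / (ρ j - ζ k)) * Real.exp (-ζ k * x) := by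
  have h0 : 0 ≤ ∑' k, coeff ρ ζ k * (ζ k / (ρ j - ζ k)) := by
    rw [h.tsum_coeff_mul_div]
    exact sub_nonneg.2 h.tsum_coeff_le_one
  refine (mul_nonneg (Real.exp_pos (-ρ j * x)).le h0).trans_lt ?_
  rw [← tsum_mul_left]
  have hlt (k : ℕ) : Real.exp (-ρ j * x) * (coeff ρ ζ k * (ζ k / (ρ j - ζ k))) <
      coeff ρ ζ k * (ζ k / (ρ j - ζ k)) * Real.exp (-ζ k * x) := by
    rw [mul_comm, mul_div_assoc', div_mul_eq_mul_div, div_mul_eq_mul_div]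
    have hp := mul_pos (h.coeff_pos k) (h.pos k)
    rcases (h.ne k j).lt_or_gt with hk | hk
    · rw [div_lt_div_iff_of_pos_right (sub_pos.2 hk), mul_lt_mul_iff_right₀ hp, Real.exp_lt_exp]
      nlinarith
    · rw [div_lt_div_right_of_neg (sub_neg.2 hk), mul_lt_mul_iff_right₀ hp, Real.exp_lt_exp]
      nlinarith
  exact Summable.tsum_lt_tsum (i := 0) (fun k => (hlt k).le) (hlt 0)
    ((h.summable_coeff_mul_div j).mul_left _) hs

end Interlacing

/-- Positivity of the entries `h₀ⱼ = bⱼ Σₖ aₖζₖe^{−aζₖ}/(ρⱼ−ζₖ)`: the series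
`ρⱼ Σₖ aₖζₖe^{−xζₖ}/(ρⱼ−ζₖ)` is the probability density of the independent sum
`e(ρⱼ) + X̄_{e(q)}`, where `X̄_{e(q)}` has Laplace transform
`φ(z) = Π (1+z/ρₙ)/(1+z/ζₙ)`, and in particular `h₀ⱼ > 0`. -/
theorem h0j_positive_via_density
    (ρ ζ : ℕ → ℝ) (a b : ℕ → ℝ)
    (hζpos : ∀ n, 0 < ζ n)
    (hinter : ∀ n, ζ n < ρ n) (hinter' : ∀ n, ρ n < ζ (n + 1))
    (hρtop : Tendsto ρ atTop atTop)
    -- the partial-fraction coefficients of φ and 1/φ as in Lemma 1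
    (ha : ∀ n, a n = (1 - ζ n / ρ n) *
      ∏' k : {k : ℕ // k ≠ n}, (1 - ζ n / ρ (k : ℕ)) / (1 - ζ n / ζ (k : ℕ)))
    (hb : ∀ n, b n = -(1 - ρ n / ζ n) *
      ∏' k : {k : ℕ // k ≠ n}, (1 - ρ n / ζ (k : ℕ)) / (1 - ρ n / ρ (k : ℕ)))
    -- absolute convergence of the relevant series
    (hconv : ∀ j : ℕ, ∀ x : ℝ, 0 < x →
      Summable (fun k => |a k * ζ k * Real.exp (-(ζ k) * x) / (ρ j - ζ k)|))
    -- μ is the law of X̄_{e(q)}, a probability measure on [0,∞) with Laplace transform φ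
    (μ : Measure ℝ) (hμprob : IsProbabilityMeasure μ) (hμsupp : μ (Iio 0) = 0)
    (hμlap : ∀ z : ℝ, 0 ≤ z →
      ∫ x, Real.exp (-z * x) ∂μ = ∏' n, (1 + z / ρ n) / (1 + z / ζ n)) :
    ∀ j : ℕ,
      -- the independent sum e(ρⱼ) + X̄_{e(q)} has the displayed density
      (Measure.map (fun p : ℝ × ℝ => p.1 + p.2) ((expMeasure (ρ j)).prod μ) =
        volume.withDensity (fun x => ENNReal.ofReal
          (Set.indicator (Ici (0 : ℝ))
            (fun y => ρ j * ∑' k, a k * ζ k * Real.exp (-(ζ k) * y) / (ρ j - ζ k)) x))) ∧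
      -- and the matrix entries h₀ⱼ are strictly positive
      (∀ x : ℝ, 0 < x →
        0 < b j * ∑' k, a k * ζ k * Real.exp (-(ζ k) * x) / (ρ j - ζ k)) := by
  intro j
  have I : Interlacing ρ ζ := ⟨hζpos, hinter, hinter', hρtop⟩
  obtain rfl : a = Interlacing.coeff ρ ζ := funext ha
  have hterm (x : ℝ) (k : ℕ) :
      Interlacing.coeff ρ ζ k * ζ k * Real.exp (-(ζ k) * x) / (ρ j - ζ k) =
        Interlacing.coeff ρ ζ k * (ζ k / (ρ j - ζ k)) * Real.exp (-ζ k * x) := by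
    ring
  have hpos (x : ℝ) (hx : 0 < x) :
      0 < ∑' k, Interlacing.coeff ρ ζ k * ζ k * Real.exp (-(ζ k) * x) / (ρ j - ζ k) := by
    have hs := (hconv j x hx).of_abs
    simp_rw [hterm] at hs ⊢
    exact I.tsum_coeff_mul_div_mul_exp_pos j hx hs
  refine ⟨?_, fun x hx => mul_pos (hb j ▸ I.reciprocal_coeff_pos j) (hpos x hx)⟩
  set g : ℝ → ℝ := fun y =>
    ρ j * ∑' k, Interlacing.coeff ρ ζ k * ζ k * Real.exp (-(ζ k) * y) / (ρ j - ζ k) with hg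
  have hg0 (x : ℝ) (hx : 0 < x) : 0 ≤ g x := (mul_pos (I.pos' j) (hpos x hx)).le
  have hlap (z : ℝ) (hz : 0 ≤ z) : ∫ x in Set.Ioi 0, Real.exp (-z * x) * g x =
      ρ j / (ρ j + z) * ∏' n, (1 + z / ρ n) / (1 + z / ζ n) := by
    simp_rw [hg, hterm, mul_left_comm _ (ρ j)]
    rw [integral_const_mul, integral_exp_neg_mul_tsum I.pos (I.summable_abs_coeff_mul_div_div j) hz,
      I.mul_tprod_eq_tsum j hz]
  have hint : IntegrableOn g (Set.Ioi 0) := by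
    refine Integrable.of_integral_ne_zero ?_
    have := hlap 0 le_rfl
    simp only [neg_zero, zero_mul, Real.exp_zero, one_mul, zero_div, add_zero, div_one,
      tprod_one, mul_one, div_self (I.pos' j).ne'] at this
    rw [this]
    exact one_ne_zero
  have := isProbabilityMeasure_expMeasure (I.pos' j)
  have := isFiniteMeasure_withDensity_indicator_Ici hint
  refine ext_of_integral_exp_neg_mul_eq (map_add_prod_Iio_eq_zero hμsupp ?_)
    (withDensity_ofReal_indicator_Ici_Iio g) fun z hz => ?_
  · rw [expMeasure_eq_withDensity]
    exact withDensity_ofReal_indicator_Ici_Iio _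
  · rw [integral_exp_neg_mul_map_add, integral_exp_neg_mul_expMeasure (I.pos' j) hz.le,
      hμlap z hz.le, integral_exp_neg_mul_withDensity hint hg0, hlap z hz.le]
end

section
/- For a > 0, γ > 0 and Re(z) > 0 one has ∫_ℝ [1/(γ + iu) − 1/(z + iu)] du = 0; and for complex a, b with Im(a) < 0 and Im(b) < 0 and Re(z) > 0, (1/(2πi)) ∫_ℝ [ln((a − u)/b)/(u − iz) − ln((b − u)/b)/u] du = ln((a − iz)/b), while if Im(a) > 0 and Im(b) > 0 the same integral equals 0 (principal branches of the logarithm, integrals as principal values / improper Riemann integrals). -/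
open Real Complex MeasureTheory
open Filter Topology Asymptotics Bornology Set

/-- The filter of neighbourhoods of infinity inside the closed upper half-plane. -/
noncomputable def upperHalfInfty : Filter ℂ := cobounded ℂ ⊓ 𝓟 {w | 0 ≤ w.im}

lemma tendsto_ofReal_upperHalfInfty :
    Tendsto ((↑) : ℝ → ℂ) (cocompact ℝ) upperHalfInfty := by
  refine tendsto_inf.2 ⟨?_, tendsto_principal.2 <| .of_forall fun x ↦ by simp⟩
  rw [← Metric.cobounded_eq_cocompact]
  exact RCLike.tendsto_ofReal_cobounded_cobounded ℂ

lemma tendsto_norm_upperHalfInfty : Tendsto (fun w : ℂ ↦ ‖w‖) upperHalfInfty atTop :=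
  tendsto_norm_cobounded_atTop.mono_left inf_le_left

lemma upperHalfInfty_eventually_ne (c : ℂ) : ∀ᶠ w in upperHalfInfty, w ≠ c := by
  filter_upwards [tendsto_norm_upperHalfInfty.eventually_gt_atTop ‖c‖] with w hw h
  exact hw.ne' (by rw [h])

lemma upperHalfInfty_eventually_im_nonneg : ∀ᶠ w in upperHalfInfty, 0 ≤ w.im :=
  mem_inf_of_right (mem_principal_self _)

lemma integrable_comp_ofReal_of_isBigO {f : ℂ → ℂ} (hc : Continuous fun x : ℝ ↦ f x)
    (hO : f =O[upperHalfInfty] fun w ↦ ‖w‖ ^ (-(3 / 2) : ℝ)) :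
    Integrable fun x : ℝ ↦ f x := by
  refine hc.locallyIntegrable.integrable_of_isBigO_cocompact
    (g := fun x : ℝ ↦ (1 + ‖x‖) ^ (-(3 / 2) : ℝ)) ?_
    (Integrable.integrableAtFilter (integrable_one_add_norm (by norm_num)) _)
  refine (hO.comp_tendsto tendsto_ofReal_upperHalfInfty).trans ?_
  refine IsBigO.of_bound (2 ^ (3 / 2 : ℝ)) ?_
  filter_upwards [(tendsto_norm_cocompact_atTop (E := ℝ)).eventually_ge_atTop 1] with x hx
  have h0 : 0 < ‖x‖ := by linarith
  rw [Function.comp_apply, Complex.norm_real,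
    Real.norm_of_nonneg (Real.rpow_nonneg (norm_nonneg x) _),
    Real.norm_of_nonneg (by positivity : 0 ≤ (1 + ‖x‖) ^ (-(3 / 2) : ℝ)),
    Real.rpow_neg h0.le, Real.rpow_neg (by positivity), ← div_eq_mul_inv, le_div_iff₀ (by positivity),
    inv_mul_le_iff₀ (by positivity), ← Real.mul_rpow h0.le (by norm_num)]
  exact Real.rpow_le_rpow (by positivity) (by linarith) (by norm_num)

/-- Cauchy's theorem for the upper half-plane. -/
lemma integral_ofReal_eq_zero_of_isBigO {f : ℂ → ℂ}
    (hd : ∀ w : ℂ, 0 ≤ w.im → DifferentiableAt ℂ f w)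
    (hO : f =O[upperHalfInfty] fun w ↦ ‖w‖ ^ (-(3 / 2) : ℝ)) :
    Integrable (fun x : ℝ ↦ f x) ∧ ∫ x : ℝ, f x = 0 := by
  have hint : Integrable fun x : ℝ ↦ f x := by
    refine integrable_comp_ofReal_of_isBigO (continuous_iff_continuousAt.2 fun x ↦ ?_) hO
    exact (hd x (by simp)).continuousAt.comp Complex.continuous_ofReal.continuousAt
  refine ⟨hint, tendsto_nhds_unique
    (intervalIntegral_tendsto_integral hint tendsto_neg_atTop_atBot tendsto_id) ?_⟩
  obtain ⟨C, hC⟩ := hO.bound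
  obtain ⟨r, hr⟩ : ∃ r : ℝ, ∀ w : ℂ, r ≤ ‖w‖ → 0 ≤ w.im → ‖f w‖ ≤ C * ‖w‖ ^ (-(3 / 2) : ℝ) := by
    rw [upperHalfInfty, eventually_inf_principal] at hC
    obtain ⟨r, -, hr⟩ := (hasBasis_cobounded_norm (E := ℂ)).eventually_iff.1 hC
    refine ⟨r, fun w hw hi ↦ (hr hw hi).trans_eq ?_⟩
    rw [Real.norm_of_nonneg (by positivity)]
  have hlim : Tendsto (fun R : ℝ ↦ 4 * |C| * R ^ (-(1 / 2) : ℝ)) atTop (𝓝 0) := by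
    simpa using (tendsto_rpow_neg_atTop (show (0 : ℝ) < 1 / 2 by norm_num)).const_mul (4 * |C|)
  refine squeeze_zero_norm' ?_ hlim
  filter_upwards [eventually_ge_atTop r, eventually_gt_atTop 0] with R hRr hR
  have hbd : ∀ w : ℂ, R ≤ ‖w‖ → 0 ≤ w.im → ‖f w‖ ≤ |C| * R ^ (-(3 / 2) : ℝ) := fun w hw hi ↦
    (hr w (hRr.trans hw) hi).trans <| mul_le_mul (le_abs_self C)
      (Real.rpow_le_rpow_of_nonpos hR hw (by norm_num)) (by positivity) (abs_nonneg C)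
  have key := integral_boundary_rect_eq_zero_of_differentiableOn f (-R : ℝ) (R + R * I) (by
    intro w hw
    refine (hd w ?_).differentiableWithinAt
    have := (mem_reProdIm.1 hw).2
    simp [uIcc_of_le hR.le] at this
    exact this.1)
  simp only [ofReal_re, ofReal_im, add_re, mul_re, I_re, I_im, add_im, mul_im, mul_zero, mul_one,
    sub_zero, zero_mul, add_zero, zero_add, ofReal_zero, smul_eq_mul] at key
  have h1 := intervalIntegral.norm_integral_le_of_norm_le_const (a := -R) (b := R)
    (f := fun x : ℝ ↦ f (x + R * I)) (C := |C| * R ^ (-(3 / 2) : ℝ)) fun x _ ↦ by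
      refine hbd _ ?_ (by simp [hR.le])
      simpa [abs_of_pos hR] using Complex.abs_im_le_norm (x + R * I)
  have h2 := intervalIntegral.norm_integral_le_of_norm_le_const (a := 0) (b := R)
    (f := fun y : ℝ ↦ f (R + y * I)) (C := |C| * R ^ (-(3 / 2) : ℝ)) fun y hy ↦ by
      rw [uIoc_of_le hR.le] at hy
      refine hbd _ ?_ (by simpa using hy.1.le)
      simpa [abs_of_pos hR] using Complex.abs_re_le_norm (R + y * I)
  have h3 := intervalIntegral.norm_integral_le_of_norm_le_const (a := 0) (b := R)
    (f := fun y : ℝ ↦ f ((-R : ℝ) + y * I)) (C := |C| * R ^ (-(3 / 2) : ℝ)) fun y hy ↦ by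
      rw [uIoc_of_le hR.le] at hy
      refine hbd _ ?_ (by simpa using hy.1.le)
      simpa [abs_of_pos hR] using Complex.abs_re_le_norm ((-R : ℝ) + y * I)
  have hpow : R ^ (-(3 / 2) : ℝ) * R = R ^ (-(1 / 2) : ℝ) := by
    rw [← Real.rpow_add_one hR.ne']; norm_num
  rw [sub_zero, abs_of_pos hR] at h2 h3
  rw [show R - -R = 2 * R by ring, abs_of_pos (by positivity : 0 < 2 * R)] at h1
  have e : (∫ x in (-R)..(id R), f x) = (∫ x : ℝ in (-R)..R, f (x + R * I))
      - I * (∫ y : ℝ in (0)..R, f (R + y * I)) + I * ∫ y : ℝ in (0)..R, f ((-R : ℝ) + y * I) := by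
    simp only [id]
    linear_combination key
  rw [e]
  refine (norm_add_le _ _).trans <| (add_le_add_left (norm_sub_le _ _) _).trans ?_
  rw [norm_mul, norm_mul, norm_I, one_mul, one_mul, ← hpow]
  linarith

lemma isBigO_sub_const_inv (p : ℂ) :
    (fun w : ℂ ↦ (w - p)⁻¹) =O[upperHalfInfty] fun w ↦ ‖w‖ ^ (-1 : ℝ) := by
  refine IsBigO.of_bound 2 ?_
  filter_upwards [tendsto_norm_upperHalfInfty.eventually_ge_atTop (2 * ‖p‖ + 1)] with w hw
  have h := norm_sub_norm_le w p
  have hp := norm_nonneg p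
  rw [Real.norm_of_nonneg (by positivity), Real.rpow_neg_one, norm_inv, ← div_eq_mul_inv,
    inv_le_comm₀ (by linarith) (by apply div_pos <;> linarith), inv_div]
  linarith

lemma isBigO_inv_sub_inv (p q : ℂ) :
    (fun w : ℂ ↦ (w - p)⁻¹ - (w - q)⁻¹) =O[upperHalfInfty] fun w ↦ ‖w‖ ^ (-2 : ℝ) := by
  have h := ((isBigO_sub_const_inv p).mul (isBigO_sub_const_inv q)).const_mul_left (p - q)
  refine h.congr' ?_ ?_
  · filter_upwards [upperHalfInfty_eventually_ne p, upperHalfInfty_eventually_ne q] with w hp hq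
    have := sub_ne_zero.2 hp
    have := sub_ne_zero.2 hq
    field_simp
    ring
  · filter_upwards [tendsto_norm_upperHalfInfty.eventually_gt_atTop 0] with w hw
    rw [← Real.rpow_add hw]; norm_num

lemma isBigO_rpow_rpow_upperHalfInfty {r s : ℝ} (h : r ≤ s) :
    (fun w : ℂ ↦ ‖w‖ ^ r) =O[upperHalfInfty] fun w ↦ ‖w‖ ^ s := by
  refine IsBigO.of_bound 1 ?_
  filter_upwards [tendsto_norm_upperHalfInfty.eventually_ge_atTop 1] with w hw
  rw [Real.norm_of_nonneg (by positivity), Real.norm_of_nonneg (by positivity), one_mul]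
  exact Real.rpow_le_rpow_of_exponent_le hw h

lemma isBigO_log_sub (a : ℂ) :
    (fun w : ℂ ↦ Complex.log (a - w)) =O[upperHalfInfty] fun w ↦ ‖w‖ ^ (1 / 2 : ℝ) := by
  have hlog : Complex.log =O[cobounded ℂ] fun w ↦ ‖w‖ ^ (1 / 2 : ℝ) := by
    have h1 : (fun w : ℂ ↦ Real.log ‖w‖) =O[cobounded ℂ] fun w ↦ ‖w‖ ^ (1 / 2 : ℝ) :=
      ((isLittleO_log_rpow_atTop (by norm_num : (0 : ℝ) < 1 / 2)).comp_tendsto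
        tendsto_norm_cobounded_atTop).isBigO
    have h2 : (fun w : ℂ ↦ w.arg) =O[cobounded ℂ] fun w ↦ ‖w‖ ^ (1 / 2 : ℝ) := by
      refine IsBigO.of_bound π ?_
      filter_upwards [tendsto_norm_cobounded_atTop.eventually_ge_atTop 1] with w hw
      rw [Real.norm_of_nonneg (by positivity : 0 ≤ ‖w‖ ^ (1 / 2 : ℝ))]
      have := Real.one_le_rpow hw (by norm_num : (0 : ℝ) ≤ 1 / 2)
      calc ‖w.arg‖ ≤ π * 1 := by simpa using Complex.abs_arg_le_pi w
        _ ≤ _ := by gcongr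
    exact (Complex.isBigO_ofReal_left.2 h1).add
      (((Complex.isBigO_ofReal_left.2 h2).mul
        (isBigO_const_const I (one_ne_zero (α := ℝ)) _)).congr_right fun _ ↦ mul_one _)
  have ht : Tendsto (fun w : ℂ ↦ a - w) upperHalfInfty (cobounded ℂ) := by
    rw [← tendsto_norm_atTop_iff_cobounded]
    refine tendsto_atTop_mono (fun w ↦ ?_)
      (tendsto_atTop_add_const_right _ (-‖a‖) tendsto_norm_upperHalfInfty)
    have := norm_sub_norm_le w a
    rw [norm_sub_rev] at this
    linarith
  refine (hlog.comp_tendsto ht).trans ?_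
  refine IsBigO.rpow (by norm_num) (.of_forall fun w ↦ norm_nonneg w) (IsBigO.of_bound 2 ?_)
  filter_upwards [tendsto_norm_upperHalfInfty.eventually_ge_atTop ‖a‖] with w hw
  have := norm_sub_le a w
  simp only [norm_norm]
  linarith

lemma Complex.log_div_of_im_neg {x y : ℂ} (hx : x.im < 0) (hy : y.im < 0) :
    Complex.log (x / y) = Complex.log x - Complex.log y := by
  have hy' : y.arg ≠ π := (Complex.arg_neg_iff.2 hy).trans Real.pi_pos |>.ne
  have hx0 : x ≠ 0 := by rintro rfl; simp at hx
  have hy0 : y ≠ 0 := by rintro rfl; simp at hy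
  have := Complex.arg_neg_iff.2 hx
  have := Complex.arg_neg_iff.2 hy
  have := Complex.neg_pi_lt_arg x
  have := Complex.neg_pi_lt_arg y
  rw [div_eq_mul_inv, Complex.log_mul hx0 (inv_ne_zero hy0), Complex.log_inv _ hy', sub_eq_add_neg]
  rw [Complex.arg_inv, if_neg hy']
  constructor <;> linarith

lemma differentiableAt_log_sub_div {a b w : ℂ} (hb : b.im < 0) (hw : a.im < w.im) :
    DifferentiableAt ℂ (fun w ↦ Complex.log ((a - w) / b)) w := by
  have hev : ∀ᶠ v in 𝓝 w, a.im < v.im := continuous_im.continuousAt.eventually_const_lt hw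
  have h : DifferentiableAt ℂ (fun w ↦ Complex.log (a - w) - Complex.log b) w := by
    refine DifferentiableAt.sub_const (DifferentiableAt.clog (by fun_prop) (Or.inr ?_)) _
    simp only [sub_im]
    linarith
  refine h.congr_of_eventuallyEq ?_
  filter_upwards [hev] with v hv
  exact Complex.log_div_of_im_neg (by simpa using hv) hb

lemma differentiableAt_dslope_log_sub_div {a b p w : ℂ} (hb : b.im < 0) (hp : a.im < p.im)
    (hw : a.im < w.im) :
    DifferentiableAt ℂ (dslope (fun w ↦ Complex.log ((a - w) / b)) p) w := by
  have ho : IsOpen {v : ℂ | a.im < v.im} := isOpen_lt continuous_const continuous_im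
  refine ((differentiableOn_dslope (ho.mem_nhds hp)).2 fun v hv ↦ ?_).differentiableAt
    (ho.mem_nhds hw)
  exact (differentiableAt_log_sub_div hb hv).differentiableWithinAt

lemma isBigO_log_sub_div_sub {a a' b : ℂ} (ha : a.im < 0) (ha' : a'.im < 0) (hb : b.im < 0) :
    (fun w : ℂ ↦ Complex.log ((a - w) / b) - Complex.log ((a' - w) / b)) =O[upperHalfInfty]
      fun w ↦ ‖w‖ ^ (-1 : ℝ) := by
  have h1 : (fun w : ℂ ↦ (a - a') * -(w - a')⁻¹) =O[upperHalfInfty] fun w ↦ ‖w‖ ^ (-1 : ℝ) :=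
    (isBigO_sub_const_inv a').neg_left.const_mul_left _
  have h0 : Tendsto (fun w : ℂ ↦ (a - a') * -(w - a')⁻¹) upperHalfInfty (𝓝 0) :=
    h1.trans_tendsto ((tendsto_rpow_neg_atTop one_pos).comp tendsto_norm_upperHalfInfty)
  refine IsBigO.trans (IsBigO.of_bound (3 / 2) ?_) h1
  filter_upwards [upperHalfInfty_eventually_im_nonneg, upperHalfInfty_eventually_ne a',
    h0.norm.eventually_le_const (by norm_num : ‖(0 : ℂ)‖ < 1 / 2)] with w hw hne hle
  have hx : (a - w).im < 0 := by simp only [sub_im]; linarith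
  have hy : (a' - w).im < 0 := by simp only [sub_im]; linarith
  have e : (a - w) / (a' - w) = 1 + (a - a') * -(w - a')⁻¹ := by
    have := sub_ne_zero.2 hne
    rw [← neg_sub w a']
    field_simp
    ring
  rw [Complex.log_div_of_im_neg hx hb, Complex.log_div_of_im_neg hy hb, sub_sub_sub_cancel_right,
    ← Complex.log_div_of_im_neg hx hy, e]
  exact Complex.norm_log_one_add_half_le_self hle

lemma differentiableAt_sub_const_inv {r w : ℂ} (hr : r.im < 0) (hw : 0 ≤ w.im) :
    DifferentiableAt ℂ (fun w ↦ (w - r)⁻¹) w := by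
  refine DifferentiableAt.fun_inv (by fun_prop) fun h ↦ ?_
  have := congrArg Complex.im h
  simp only [sub_im, zero_im] at this
  linarith

lemma integral_log_sub_div_of_im_neg {a b q c : ℂ} {D : ℂ → ℂ} (ha : a.im < 0) (hb : b.im < 0)
    (hD : ∀ w : ℂ, 0 ≤ w.im → DifferentiableAt ℂ D w)
    (hDq : ∀ w, w ≠ q → D w = (Complex.log ((a - w) / b) - c) / (w - q)) (hq : q.im ≠ 0) :
    Integrable (fun x : ℝ ↦ Complex.log ((a - x) / b) / (x - q) - Complex.log ((b - x) / b) / x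
      - c * (((x : ℂ) - q)⁻¹ - ((x : ℂ) - -I)⁻¹)) ∧
    ∫ x : ℝ, (Complex.log ((a - x) / b) / (x - q) - Complex.log ((b - x) / b) / x
      - c * (((x : ℂ) - q)⁻¹ - ((x : ℂ) - -I)⁻¹)) = 0 := by
  have hb0 : b ≠ 0 := by rintro rfl; simp at hb
  set E := dslope (fun w ↦ Complex.log ((b - w) / b)) 0 with hE
  have hE0 : ∀ w, w ≠ 0 → E w = Complex.log ((b - w) / b) / w := fun w hw ↦ by
    rw [hE, dslope_of_ne _ hw, slope_def_field]
    simp [hb0]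
  have hdiff : ∀ w : ℂ, 0 ≤ w.im → DifferentiableAt ℂ (fun w ↦ D w - E w + c * (w - -I)⁻¹) w := by
    intro w hw
    exact ((hD w hw).sub (differentiableAt_dslope_log_sub_div hb (by simpa) (by linarith))).add
      ((differentiableAt_sub_const_inv (by simp) hw).const_mul c)
  have hO : (fun w ↦ D w - E w + c * (w - -I)⁻¹) =O[upperHalfInfty]
      fun w ↦ ‖w‖ ^ (-(3 / 2) : ℝ) := by
    have hlog : (fun w : ℂ ↦ Complex.log ((a - w) / b)) =O[upperHalfInfty]
        fun w ↦ ‖w‖ ^ (1 / 2 : ℝ) := by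
      have hc : (fun _ : ℂ ↦ Complex.log b) =O[upperHalfInfty] fun w ↦ ‖w‖ ^ (1 / 2 : ℝ) := by
        simpa using (isBigO_const_const (Complex.log b) (one_ne_zero (α := ℝ)) upperHalfInfty).trans
          (by simpa using isBigO_rpow_rpow_upperHalfInfty (by norm_num : (0 : ℝ) ≤ 1 / 2))
      refine ((isBigO_log_sub a).sub hc).congr' ?_ .rfl
      filter_upwards [upperHalfInfty_eventually_im_nonneg] with w hw
      exact (Complex.log_div_of_im_neg (by simp only [sub_im]; linarith) hb).symm
    have hpos := tendsto_norm_upperHalfInfty.eventually_gt_atTop 0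
    have t1 : (fun w : ℂ ↦ Complex.log ((a - w) / b) * ((w - q)⁻¹ - (w - 0)⁻¹)) =O[upperHalfInfty]
        fun w ↦ ‖w‖ ^ (-(3 / 2) : ℝ) := by
      refine (hlog.mul (isBigO_inv_sub_inv q 0)).congr' .rfl ?_
      filter_upwards [hpos] with w hw
      rw [← Real.rpow_add hw]; norm_num
    have t2 : (fun w : ℂ ↦ (Complex.log ((a - w) / b) - Complex.log ((b - w) / b)) * (w - 0)⁻¹)
        =O[upperHalfInfty] fun w ↦ ‖w‖ ^ (-(3 / 2) : ℝ) := by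
      refine (((isBigO_log_sub_div_sub ha hb hb).mul (isBigO_sub_const_inv 0)).congr' .rfl
        ?_).trans (isBigO_rpow_rpow_upperHalfInfty (by norm_num : (-2 : ℝ) ≤ -(3 / 2)))
      filter_upwards [hpos] with w hw
      rw [← Real.rpow_add hw]; norm_num
    have t3 : (fun w : ℂ ↦ c * ((w - q)⁻¹ - (w - -I)⁻¹)) =O[upperHalfInfty]
        fun w ↦ ‖w‖ ^ (-(3 / 2) : ℝ) :=
      ((isBigO_inv_sub_inv q (-I)).const_mul_left c).trans
        (isBigO_rpow_rpow_upperHalfInfty (by norm_num))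
    refine ((t1.add t2).sub t3).congr' ?_ .rfl
    filter_upwards [upperHalfInfty_eventually_ne q, upperHalfInfty_eventually_ne 0] with w hwq hw0
    rw [hDq _ hwq, hE0 _ hw0]
    ring
  obtain ⟨h1, h2⟩ := integral_ofReal_eq_zero_of_isBigO hdiff hO
  have hae : (fun x : ℝ ↦ D x - E x + c * ((x : ℂ) - -I)⁻¹) =ᵐ[volume]
      fun x : ℝ ↦ Complex.log ((a - x) / b) / (x - q) - Complex.log ((b - x) / b) / x
        - c * (((x : ℂ) - q)⁻¹ - ((x : ℂ) - -I)⁻¹) := by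
    filter_upwards [compl_mem_ae_iff.2 (measure_singleton (0 : ℝ))] with x hx
    have hx0 : (x : ℂ) ≠ 0 := by simpa using hx
    have hxq : (x : ℂ) ≠ q := by rintro rfl; simp at hq
    rw [hDq _ hxq, hE0 _ hx0]
    ring
  exact ⟨h1.congr hae, (integral_congr_ae hae).symm.trans h2⟩

lemma integral_inv_sub_inv_of_im_neg {p q : ℂ} (hp : p.im < 0) (hq : q.im < 0) :
    Integrable (fun x : ℝ ↦ ((x : ℂ) - p)⁻¹ - ((x : ℂ) - q)⁻¹) ∧
      ∫ x : ℝ, (((x : ℂ) - p)⁻¹ - ((x : ℂ) - q)⁻¹) = 0 := by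
  exact integral_ofReal_eq_zero_of_isBigO (fun w hw ↦ (differentiableAt_sub_const_inv hp hw).sub
    (differentiableAt_sub_const_inv hq hw))
    ((isBigO_inv_sub_inv p q).trans (isBigO_rpow_rpow_upperHalfInfty (by norm_num)))

lemma integral_inv_sub_inv_of_im_pos {p q : ℂ} (hp : 0 < p.im) (hq : 0 < q.im) :
    Integrable (fun x : ℝ ↦ ((x : ℂ) - p)⁻¹ - ((x : ℂ) - q)⁻¹) ∧
      ∫ x : ℝ, (((x : ℂ) - p)⁻¹ - ((x : ℂ) - q)⁻¹) = 0 := by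
  obtain ⟨h1, h2⟩ := integral_inv_sub_inv_of_im_neg (p := -p) (q := -q) (by simpa) (by simpa)
  have e : ∀ x : ℝ, (((-x : ℝ) : ℂ) - -p)⁻¹ - (((-x : ℝ) : ℂ) - -q)⁻¹
      = -(((x : ℂ) - p)⁻¹ - ((x : ℂ) - q)⁻¹) := fun x ↦ by
    rw [ofReal_neg, neg_sub_neg, neg_sub_neg, ← neg_sub (x : ℂ) p, ← neg_sub (x : ℂ) q, inv_neg,
      inv_neg]
    ring
  refine ⟨h1.comp_neg.neg.congr (.of_forall fun x ↦ ?_), ?_⟩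
  · rw [Pi.neg_apply, e, neg_neg]
  rw [← integral_neg_eq_self] at h2
  simp_rw [e] at h2
  rwa [integral_neg, neg_eq_zero] at h2

lemma integral_inv_sub_inv_neg_I {p : ℂ} (hp : 0 < p.im) :
    Integrable (fun x : ℝ ↦ ((x : ℂ) - p)⁻¹ - ((x : ℂ) - -I)⁻¹) ∧
      ∫ x : ℝ, (((x : ℂ) - p)⁻¹ - ((x : ℂ) - -I)⁻¹) = 2 * π * I := by
  obtain ⟨h1, h2⟩ := integral_inv_sub_inv_of_im_pos (p := p) (q := I) hp (by simp)
  have h3 : Integrable fun x : ℝ ↦ 2 * I * (((1 + x ^ 2)⁻¹ : ℝ) : ℂ) :=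
    integrable_inv_one_add_sq.ofReal.const_mul _
  have e : (fun x : ℝ ↦ ((x : ℂ) - p)⁻¹ - ((x : ℂ) - -I)⁻¹) = fun x : ℝ ↦
      (((x : ℂ) - p)⁻¹ - ((x : ℂ) - I)⁻¹) + 2 * I * (((1 + x ^ 2)⁻¹ : ℝ) : ℂ) := by
    funext x
    have hx1 : (x : ℂ) - I ≠ 0 := fun h ↦ by simpa using congrArg Complex.im h
    have hx2 : (x : ℂ) - -I ≠ 0 := fun h ↦ by simpa using congrArg Complex.im h
    have hx3 : (1 + (x : ℂ) ^ 2) = (x - I) * (x - -I) := by linear_combination I_sq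
    push_cast
    rw [hx3]
    field_simp
    ring
  rw [e]
  refine ⟨h1.add h3, ?_⟩
  rw [integral_add h1 h3, h2, integral_const_mul, integral_complex_ofReal, integral_univ_inv_one_add_sq]
  ring

/-- The two residue-calculus integral identities: for `γ > 0`, `Re z > 0`,
`∫_ℝ (1/(γ+iu) - 1/(z+iu)) du = 0`; and for `Im a, Im b < 0` (resp. `> 0`),
`(1/(2πi)) ∫_ℝ (log((a-u)/b)/(u-iz) - log((b-u)/b)/u) du` equals `log((a-iz)/b)`
(resp. `0`), with principal branch logarithms. -/
theorem residue_integral_identities (γ : ℝ) (z a b : ℂ)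
    (hγ : 0 < γ) (hz : 0 < z.re) :
    (∫ u : ℝ, (1 / ((γ : ℂ) + Complex.I * u) - 1 / (z + Complex.I * u)) = 0) ∧
    (a.im < 0 → b.im < 0 →
      (1 / (2 * Real.pi * Complex.I)) *
        ∫ u : ℝ, (Complex.log ((a - u) / b) / ((u : ℂ) - Complex.I * z)
          - Complex.log ((b - u) / b) / (u : ℂ)) = Complex.log ((a - Complex.I * z) / b)) ∧
    (0 < a.im → 0 < b.im →
      (1 / (2 * Real.pi * Complex.I)) *
        ∫ u : ℝ, (Complex.log ((a - u) / b) / ((u : ℂ) - Complex.I * z)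
          - Complex.log ((b - u) / b) / (u : ℂ)) = 0) := by
  have hzI : (I * z).im = z.re := by simp
  refine ⟨?_, fun ha hb ↦ ?_, fun ha hb ↦ ?_⟩
  · have h := (integral_inv_sub_inv_of_im_pos (p := I * γ) (q := I * z) (by simpa) (by simpa)).2
    have e : ∀ (u : ℝ) (s : ℂ), 1 / (s + I * u) = -I * ((u : ℂ) - I * s)⁻¹ := fun u s ↦ by
      rw [show s + I * u = I * (u - I * s) by linear_combination s * I_sq, one_div, mul_inv, inv_I]
    simp_rw [e, ← mul_sub]
    rw [integral_const_mul, h, mul_zero]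
  · set L := fun w ↦ Complex.log ((a - w) / b) with hL
    obtain ⟨h1, h2⟩ := integral_log_sub_div_of_im_neg (q := I * z) (c := L (I * z))
      (D := dslope L (I * z)) ha hb
      (fun w hw ↦ differentiableAt_dslope_log_sub_div hb (by linarith) (by linarith))
      (fun w hw ↦ by rw [dslope_of_ne _ hw, slope_def_field]) (by linarith)
    obtain ⟨h3, h4⟩ := integral_inv_sub_inv_neg_I (p := I * z) (by linarith)
    have h := integral_add h1 (h3.const_mul (L (I * z)))
    rw [h2, integral_const_mul, h4] at h
    simp only [sub_add_cancel, zero_add] at h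
    rw [h]
    have := Complex.two_pi_I_ne_zero
    field_simp
    rfl
  · obtain ⟨-, h⟩ := integral_log_sub_div_of_im_neg (a := -a) (b := -b) (q := -(I * z)) (c := 0)
      (D := fun w ↦ Complex.log ((-a - w) / -b) / (w - -(I * z))) (by simpa) (by simpa)
      (fun w hw ↦ by
        simp_rw [div_eq_mul_inv _ (_ - -(I * z))]
        exact (differentiableAt_log_sub_div (by simpa) (by rw [neg_im]; linarith)).mul
          (differentiableAt_sub_const_inv (by rw [neg_im, hzI]; linarith) hw))
      (fun w _ ↦ by rw [sub_zero]) (by rw [neg_im, hzI]; linarith)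
    have e : ∀ x : ℝ, Complex.log ((-a - (-x : ℝ)) / -b) / ((-x : ℝ) - -(I * z))
        - Complex.log ((-b - (-x : ℝ)) / -b) / (-x : ℝ)
          - 0 * ((((-x : ℝ) : ℂ) - -(I * z))⁻¹ - (((-x : ℝ) : ℂ) - -I)⁻¹)
        = -(Complex.log ((a - x) / b) / (x - I * z) - Complex.log ((b - x) / b) / x) := fun x ↦ by
      rw [ofReal_neg, neg_sub_neg, neg_sub_neg, neg_sub_neg, ← neg_sub a, ← neg_sub b,
        neg_div_neg_eq, neg_div_neg_eq, ← neg_sub (x : ℂ) (I * z), div_neg, div_neg]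
      ring
    rw [← integral_neg_eq_self] at h
    simp_rw [e] at h
    rw [integral_neg, neg_eq_zero] at h
    rw [h, mul_zero]
end
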